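/- arXiv:1904.08820 — 14 statements merged into one kernel-verified Lean document; each statement's English description precedes it below -/
import Mathlib

section
/- Let n ≥ 3 be an integer and α ∈ (0,1). Define x = (1/cos(π/n))·(cos(π(1−2α)/n) − sqrt( sin(2πα/n) · sin(2π(1−α)/n) )), l₁ = sqrt(1 + x² − 2x·cos(2π(1−α)/n)) and l₂ = sqrt(1 + x² − 2x·cos(2πα/n)), and φ = (n−2)π/(2n). Then 0 < x < 1 and l₁·l₂·cos φ = 1 + x²·cos(2π/n) − 2x·cos(π/n)·cos(π(2α−1)/n). -/
open Real

/-- The relation `c * (1 + x ^ 2) = 2 * C * x` turns a law-of-cosines expression into a product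
of sines. -/
lemma one_add_sq_sub_two_mul_cos {a b x : ℝ} (hc : cos a ≠ 0)
    (hq : cos a * (1 + x ^ 2) = 2 * cos b * x) :
    1 + x ^ 2 - 2 * x * cos (a + b) = 2 * x * sin a / cos a * sin (a + b) := by
  field_simp
  rw [cos_add, sin_add]
  linear_combination hq - 2 * x * cos b * sin_sq_add_cos_sq a

/-- The radius relation in terms of the half-sum `a` and half-difference `b` of the angles. -/
lemma radius_relation_of_abs_lt {a b x : ℝ} (ha : a < π / 2) (hb : |b| < a)
    (hx : x = 1 / cos a * (cos b - √(sin (a - b) * sin (a + b)))) :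
    (0 < x ∧ x < 1) ∧
      √(1 + x ^ 2 - 2 * x * cos (a + b)) * √(1 + x ^ 2 - 2 * x * cos (a - b)) * sin a =
        1 + x ^ 2 * cos (2 * a) - 2 * x * cos a * cos b := by
  obtain ⟨hb₁, hb₂⟩ := abs_lt.mp hb
  have ha₀ : 0 < a := (abs_nonneg b).trans_lt hb
  have hc : 0 < cos a := cos_pos_of_mem_Ioo ⟨by linarith, ha⟩
  have hs : 0 < sin a := sin_pos_of_pos_of_lt_pi ha₀ (by linarith)
  have hA : 0 < sin (a - b) := sin_pos_of_pos_of_lt_pi (by linarith) (by linarith)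
  have hB : 0 < sin (a + b) := sin_pos_of_pos_of_lt_pi (by linarith) (by linarith)
  have hC : cos a < cos b := by
    rw [← cos_abs b]
    exact cos_lt_cos_of_nonneg_of_le_pi (abs_nonneg b) (by linarith) hb
  have hprod : sin (a - b) * sin (a + b) = cos b ^ 2 - cos a ^ 2 := by
    rw [sin_sub, sin_add]
    linear_combination cos b ^ 2 * sin_sq_add_cos_sq a - cos a ^ 2 * sin_sq_add_cos_sq b
  set S := √(sin (a - b) * sin (a + b)) with hS
  have hS₀ : 0 < S := sqrt_pos.mpr (mul_pos hA hB)
  have hS₂ : S ^ 2 = cos b ^ 2 - cos a ^ 2 := by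
    rw [hS, sq_sqrt (mul_pos hA hB).le, hprod]
  have hcx : cos a * x = cos b - S := by
    rw [hx]
    field_simp
  have hx₀ : 0 < x := by
    refine pos_of_mul_pos_right (a := cos a) ?_ hc.le
    rw [hcx]
    nlinarith
  have hx₁ : x < 1 := by
    refine lt_of_mul_lt_mul_left (a := cos a) ?_ hc.le
    rw [hcx]
    nlinarith
  have hq : cos a * (1 + x ^ 2) = 2 * cos b * x := by
    apply mul_left_cancel₀ hc.ne'
    linear_combination (cos a * x - cos b - S) * hcx + hS₂
  refine ⟨⟨hx₀, hx₁⟩, ?_⟩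
  have h₂ := one_add_sq_sub_two_mul_cos (b := -b) hc.ne' (by rwa [cos_neg])
  rw [← sub_eq_add_neg] at h₂
  have hk : 0 ≤ 2 * x * sin a / cos a := by positivity
  have hl : √(1 + x ^ 2 - 2 * x * cos (a + b)) * √(1 + x ^ 2 - 2 * x * cos (a - b)) =
      2 * x * sin a / cos a * S := by
    rw [one_add_sq_sub_two_mul_cos hc.ne' hq, h₂, sqrt_mul hk, sqrt_mul hk, hS, sqrt_mul hA.le]
    linear_combination √(sin (a + b)) * √(sin (a - b)) * mul_self_sqrt hk
  rw [hl, cos_two_mul]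
  field_simp
  rw [sin_sq]
  linear_combination 2 * x * (1 - cos a ^ 2) * hcx - hq

/-- For an integer `n ≥ 3` and `α ∈ (0,1)`, with
`x = (1/cos(π/n))·(cos(π(1−2α)/n) − sqrt(sin(2πα/n)·sin(2π(1−α)/n)))`,
`l₁ = sqrt(1 + x² − 2x·cos(2π(1−α)/n))`, `l₂ = sqrt(1 + x² − 2x·cos(2πα/n))`, and
`φ = (n−2)π/(2n)`, one has `0 < x < 1` and
`l₁·l₂·cos φ = 1 + x²·cos(2π/n) − 2x·cos(π/n)·cos(π(2α−1)/n)`. -/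
theorem radius_relation (n : ℕ) (hn : 3 ≤ n) (α : ℝ) (hα : α ∈ Set.Ioo (0 : ℝ) 1)
    (x l₁ l₂ φ : ℝ)
    (hx : x = (1 / Real.cos (π / n)) *
      (Real.cos (π * (1 - 2 * α) / n) -
        Real.sqrt (Real.sin (2 * π * α / n) * Real.sin (2 * π * (1 - α) / n))))
    (hl₁ : l₁ = Real.sqrt (1 + x ^ 2 - 2 * x * Real.cos (2 * π * (1 - α) / n)))
    (hl₂ : l₂ = Real.sqrt (1 + x ^ 2 - 2 * x * Real.cos (2 * π * α / n)))
    (hφ : φ = ((n : ℝ) - 2) * π / (2 * n)) :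
    (0 < x ∧ x < 1) ∧
      l₁ * l₂ * Real.cos φ =
        1 + x ^ 2 * Real.cos (2 * π / n) -
          2 * x * Real.cos (π / n) * Real.cos (π * (2 * α - 1) / n) := by
  have hn' : (3 : ℝ) ≤ n := by exact_mod_cast hn
  have hn₀ : (0 : ℝ) < n := by linarith
  obtain ⟨hα₀, hα₁⟩ := hα
  have hA : 2 * π * α / n = π / n - π * (1 - 2 * α) / n := by ring
  have hB : 2 * π * (1 - α) / n = π / n + π * (1 - 2 * α) / n := by ring
  have hb : π * (2 * α - 1) / n = -(π * (1 - 2 * α) / n) := by ring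
  have h2 : 2 * π / n = 2 * (π / n) := by ring
  have hφ' : φ = π / 2 - π / n := by
    rw [hφ]
    field_simp
  rw [hA, hB] at hx
  rw [hl₁, hl₂, hA, hB, hφ', cos_pi_div_two_sub, hb, cos_neg, h2]
  refine radius_relation_of_abs_lt ?_ ?_ hx
  · exact div_lt_div_of_pos_left pi_pos two_pos (by linarith)
  · rw [abs_div, abs_mul, abs_of_pos pi_pos, abs_of_pos hn₀]
    gcongr
    exact mul_lt_of_lt_one_right pi_pos (abs_lt.mpr ⟨by linarith, by linarith⟩)
end

section
/- Let n ≥ 3 be an integer and α ∈ (0,1). With x = (1/cos(π/n))·(cos(π(1−2α)/n) − sqrt( sin(2πα/n) · sin(2π(1−α)/n) )), l₁ = sqrt(1 + x² − 2x·cos(2π(1−α)/n)) and l₂ = sqrt(1 + x² − 2x·cos(2πα/n)), one has l₁/l₂ = sqrt( sin(2π(1−α)/n) / sin(2πα/n) ). -/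
open Real

theorem cos_sq_sub_cos_sq_eq_sin_mul_sin (p d : ℝ) :
    Real.cos d ^ 2 - Real.cos p ^ 2 = Real.sin (p - d) * Real.sin (p + d) := by
  rw [Real.sin_sub, Real.sin_add]
  linear_combination Real.cos p ^ 2 * Real.sin_sq_add_cos_sq d -
    Real.cos d ^ 2 * Real.sin_sq_add_cos_sq p

/-- If `x` is a root of `cos p * x ^ 2 - 2 * cos d * x + cos p`, the squared distances
from `x` to the unit vectors at angles `p + d` and `p - d` are proportional to the sines
of these angles. -/
theorem sq_dist_mul_sin_eq_of_root {p d x : ℝ}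
    (h : Real.cos p * (1 + x ^ 2) = 2 * x * Real.cos d) :
    (1 + x ^ 2 - 2 * x * Real.cos (p + d)) * Real.sin (p - d) =
      Real.sin (p + d) * (1 + x ^ 2 - 2 * x * Real.cos (p - d)) := by
  rw [Real.sin_sub, Real.sin_add, Real.cos_sub, Real.cos_add]
  linear_combination (-2 * Real.sin d) * h +
    4 * x * Real.sin d * Real.cos d * Real.sin_sq_add_cos_sq p

theorem sq_dist_pos_of_sin_ne_zero {θ : ℝ} (h : Real.sin θ ≠ 0) (x : ℝ) :
    0 < 1 + x ^ 2 - 2 * x * Real.cos θ := by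
  nlinarith [sq_nonneg (x - Real.cos θ), Real.sin_sq_add_cos_sq θ, pow_pos (abs_pos.mpr h) 2,
    sq_abs (Real.sin θ)]

/-- For an integer `n ≥ 3` and `α ∈ (0,1)`, with
`x = (1/cos(π/n))·(cos(π(1−2α)/n) − sqrt(sin(2πα/n)·sin(2π(1−α)/n)))`,
`l₁ = sqrt(1 + x² − 2x·cos(2π(1−α)/n))` and `l₂ = sqrt(1 + x² − 2x·cos(2πα/n))`, one has
`l₁ / l₂ = sqrt( sin(2π(1−α)/n) / sin(2πα/n) )`. -/
theorem stretch_parameter_relation (n : ℕ) (hn : 3 ≤ n) (α : ℝ)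
    (hα : α ∈ Set.Ioo (0 : ℝ) 1) (x l₁ l₂ : ℝ)
    (hx : x = (1 / Real.cos (π / n)) *
      (Real.cos (π * (1 - 2 * α) / n) -
        Real.sqrt (Real.sin (2 * π * α / n) * Real.sin (2 * π * (1 - α) / n))))
    (hl₁ : l₁ = Real.sqrt (1 + x ^ 2 - 2 * x * Real.cos (2 * π * (1 - α) / n)))
    (hl₂ : l₂ = Real.sqrt (1 + x ^ 2 - 2 * x * Real.cos (2 * π * α / n))) :
    l₁ / l₂ = Real.sqrt (Real.sin (2 * π * (1 - α) / n) / Real.sin (2 * π * α / n)) := by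
  obtain ⟨h0, h1⟩ := hα
  have hn' : (3 : ℝ) ≤ n := by exact_mod_cast hn
  have hn0 : (0 : ℝ) < n := by linarith
  have hA : 2 * π * α / n = π / n - π * (1 - 2 * α) / n := by ring
  have hB : 2 * π * (1 - α) / n = π / n + π * (1 - 2 * α) / n := by ring
  have hp : 0 < π / n := div_pos pi_pos hn0
  have hp3 : π / n ≤ π / 3 := div_le_div_of_nonneg_left pi_pos.le (by norm_num) hn'
  have hcos : 0 < Real.cos (π / n) :=
    Real.cos_pos_of_mem_Ioo ⟨by linarith [pi_pos], by linarith [pi_pos]⟩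
  have hsin : ∀ t : ℝ, 0 < t → t < 1 → 0 < Real.sin (2 * π * t / n) := by
    intro t ht0 ht1
    have e : 2 * π * t / n = 2 * t * (π / n) := by ring
    rw [e]
    apply Real.sin_pos_of_pos_of_lt_pi
    · positivity
    · nlinarith [pi_pos]
  have hsA := hsin α h0 h1
  have hsB := hsin (1 - α) (by linarith) (by linarith)
  have hsq := Real.sq_sqrt (mul_pos hsA hsB).le
  rw [hA, hB] at hsq hx
  rw [hA] at hsA hl₂
  rw [hB] at hsB hl₁
  rw [hA, hB, hl₁, hl₂]
  rw [← cos_sq_sub_cos_sq_eq_sin_mul_sin] at hsq hx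
  generalize π / (n : ℝ) = p at *
  generalize π * (1 - 2 * α) / (n : ℝ) = d at *
  have hroot : Real.cos p * (1 + x ^ 2) = 2 * x * Real.cos d := by
    have hx' : Real.cos p * x =
        Real.cos d - Real.sqrt (Real.cos d ^ 2 - Real.cos p ^ 2) := by
      rw [hx]
      field_simp
    generalize Real.sqrt (Real.cos d ^ 2 - Real.cos p ^ 2) = r at *
    apply mul_left_cancel₀ hcos.ne'
    linear_combination (Real.cos p * x - Real.cos d - r) * hx' + hsq
  rw [← Real.sqrt_div (sq_dist_pos_of_sin_ne_zero hsB.ne' x).le]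
  congr 1
  rw [div_eq_div_iff (sq_dist_pos_of_sin_ne_zero hsA.ne' x).ne' hsA.ne']
  exact sq_dist_mul_sin_eq_of_root hroot
end

section
/- Let n ≥ 3 be an integer, α ∈ (0,1), and let r_I = (1/cos(π/n))·(cos(π(1−2α)/n) − sqrt( sin(2πα/n) · sin(2π(1−α)/n) )). Define the vertices E_i = (cos(2π(i−1)/n), sin(2π(i−1)/n)) and I_i = r_I·(cos(2π(i−1)/n + 2πα/n), sin(2π(i−1)/n + 2πα/n)) for i = 1,…,n, the outer polygon Ω_n^E = conv{E₁,…,E_n}, the inner polygon Ω_n^I = conv{I₁,…,I_n}, and the 2n open triangles T_i given for odd i by the interior of conv{E_{(i+1)/2}, I_{(i−1)/2}, I_{(i+1)/2}} and for even i by the interior of conv{E_{i/2}, I_{i/2}, E_{1+i/2}} (with indices modulo n). Let e₁₁ = (E₁ − I₁)/|E₁ − I₁|, let e₁₁^⊥ be its counterclockwise rotation by π/2, let a = sqrt( sin(2π(1−α)/n) / sin(2πα/n) ), and set U = a·e₁₁⊗e₁₁ + a⁻¹·e₁₁^⊥⊗e₁₁^⊥ + (a⁻¹ − a)·tan(π/n)·e₁₁⊗e₁₁^⊥.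 Let 𝒫_n = B·(𝒫̂_n)·Bᵀ where B is the orthogonal matrix with columns e₁₁, e₁₁^⊥ and 𝒫̂_n = {Q(2πj/n) : 0 ≤ j ≤ n−1} ∪ {diag(1,−1)·Q(2πj/n) : 0 ≤ j ≤ n−1}. Then there exists a locally Lipschitz map u : ℝ² → ℝ² such that: u is affine on each triangle T_i (i = 1,…,2n); u(x) = x for all x outside Ω_n^E; u(x) = R₊x on Ω_n^I, where R₊ = Q(2π(1−2α)/n); and for almost every x in Ω_n^E ∖ Ω_n^I the gradient satisfies ∇u(x) ∈ ⋃_{P ∈ 𝒫_n} SO(2)·P·U·Pᵀ. -/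
open Real Matrix MeasureTheory

noncomputable section

/-- Planar rotation by angle `θ`. -/
def Qrot (θ : ℝ) : Matrix (Fin 2) (Fin 2) ℝ :=
  !![Real.cos θ, -Real.sin θ; Real.sin θ, Real.cos θ]

/-- The set of rotations `SO(2)`, realised as `2×2` real matrices. -/
def SO2 : Set (Matrix (Fin 2) (Fin 2) ℝ) := {R | R * Rᵀ = 1 ∧ R.det = 1}

/-- The standard dihedral group `𝒫̂_n` of order `2n`, realised as a set of orthogonal
`2×2` matrices: rotations by `2πj/n` together with their compositions with the
reflection `diag(1,−1)`. -/
def dihedral (n : ℕ) : Set (Matrix (Fin 2) (Fin 2) ℝ) :=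
  {M | ∃ j : ℕ, j < n ∧ M = Qrot (2 * π * j / n)} ∪
    {M | ∃ j : ℕ, j < n ∧ M = !![(1 : ℝ), 0; 0, -1] * Qrot (2 * π * j / n)}

namespace Conti

/-- The unit vector in direction `θ`. -/
def dir (θ : ℝ) : Fin 2 → ℝ := ![Real.cos θ, Real.sin θ]

@[simp] lemma dir_zero_apply (θ : ℝ) : dir θ 0 = Real.cos θ := rfl

@[simp] lemma dir_one_apply (θ : ℝ) : dir θ 1 = Real.sin θ := rfl

lemma dir_add_int_mul_two_pi (θ : ℝ) (m : ℤ) : dir (θ + m * (2 * π)) = dir θ := by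
  simp [dir, Real.cos_add_int_mul_two_pi, Real.sin_add_int_mul_two_pi]

lemma dir_interpolation (φ θ ψ : ℝ) :
    Real.sin (ψ - φ) • dir θ = Real.sin (ψ - θ) • dir φ + Real.sin (θ - φ) • dir ψ := by
  have h1 := Real.sin_sq_add_cos_sq φ
  have h2 := Real.sin_sq_add_cos_sq θ
  have h3 := Real.sin_sq_add_cos_sq ψ
  ext i
  fin_cases i <;> simp [Real.sin_sub] <;> ring

lemma Qrot_mulVec_dir (θ φ : ℝ) : Qrot θ *ᵥ dir φ = dir (θ + φ) := by
  ext i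
  fin_cases i <;>
    simp [Qrot, Matrix.mulVec, dotProduct, Fin.sum_univ_two, Real.cos_add, Real.sin_add]
  ring

lemma exists_eq_smul_dir (x : Fin 2 → ℝ) :
    ∃ ρ θ : ℝ, 0 ≤ ρ ∧ -π < θ ∧ θ ≤ π ∧ x = ρ • dir θ := by
  refine ⟨‖(⟨x 0, x 1⟩ : ℂ)‖, Complex.arg ⟨x 0, x 1⟩, norm_nonneg _, Complex.neg_pi_lt_arg _,
    Complex.arg_le_pi _, ?_⟩
  ext i
  fin_cases i
  · simp
  · simp

/-- A nonnegative combination of two directions points in a direction between them. -/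
lemma exists_dir_of_cone {φ ψ : ℝ} (h1 : φ < ψ) (h2 : ψ < φ + π) {p q : ℝ}
    (hp : 0 ≤ p) (hq : 0 ≤ q) :
    ∃ ρ θ : ℝ, 0 ≤ ρ ∧ φ ≤ θ ∧ θ ≤ ψ ∧ p • dir φ + q • dir ψ = ρ • dir θ := by
  obtain ⟨ρ, t, hρ, ht1, ht2, ht⟩ := exists_eq_smul_dir (p • dir 0 + q • dir (ψ - φ))
  have e0 : p + q * Real.cos (ψ - φ) = ρ * Real.cos t := by simpa using congrFun ht 0
  have e1 : q * Real.sin (ψ - φ) = ρ * Real.sin t := by simpa using congrFun ht 1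
  have hβ : 0 < Real.sin (ψ - φ) := Real.sin_pos_of_pos_of_lt_pi (by linarith) (by linarith)
  have e2 : ρ * Real.sin (ψ - φ - t) = p * Real.sin (ψ - φ) := by
    rw [Real.sin_sub (ψ - φ) t]
    linear_combination Real.cos (ψ - φ) * e1 - Real.sin (ψ - φ) * e0
  have hx : p • dir φ + q • dir ψ = ρ • dir (φ + t) := by
    have h0 : Qrot φ *ᵥ (p • dir 0 + q • dir (ψ - φ)) = Qrot φ *ᵥ (ρ • dir t) := by rw [ht]
    simpa only [Matrix.mulVec_add, Matrix.mulVec_smul, Qrot_mulVec_dir, add_zero,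
      add_sub_cancel] using h0
  rcases hρ.eq_or_lt with rfl | hρ
  · exact ⟨0, φ, le_rfl, le_rfl, h1.le, by simpa using hx⟩
  have s1 : 0 ≤ Real.sin t := by
    have := mul_nonneg hq hβ.le
    rw [e1] at this
    exact nonneg_of_mul_nonneg_right this hρ
  have s2 : 0 ≤ Real.sin (ψ - φ - t) := by
    have := mul_nonneg hp hβ.le
    rw [← e2] at this
    exact nonneg_of_mul_nonneg_right this hρ
  have t0 : 0 ≤ t := by
    by_contra! h
    exact absurd s1 (Real.sin_neg_of_neg_of_neg_pi_lt h ht1).not_ge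
  have t1 : t ≤ ψ - φ := by
    by_contra! h
    exact absurd s2 (Real.sin_neg_of_neg_of_neg_pi_lt (by linarith) (by linarith)).not_ge
  exact ⟨ρ, φ + t, hρ.le, by linarith, by linarith, hx⟩

/-- The planar cross product. -/
def cross (x y : Fin 2 → ℝ) : ℝ := x 0 * y 1 - x 1 * y 0

/-- The coefficient of `e` in the basis `(e, f)`. -/
def coordFst (e f : Fin 2 → ℝ) : (Fin 2 → ℝ) →L[ℝ] ℝ :=
  (cross e f)⁻¹ • (f 1 • ContinuousLinearMap.proj (R := ℝ) (φ := fun _ : Fin 2 => ℝ) 0 -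
    f 0 • ContinuousLinearMap.proj (R := ℝ) (φ := fun _ : Fin 2 => ℝ) 1)

/-- The coefficient of `f` in the basis `(e, f)`. -/
def coordSnd (e f : Fin 2 → ℝ) : (Fin 2 → ℝ) →L[ℝ] ℝ :=
  (cross e f)⁻¹ • (e 0 • ContinuousLinearMap.proj (R := ℝ) (φ := fun _ : Fin 2 => ℝ) 1 -
    e 1 • ContinuousLinearMap.proj (R := ℝ) (φ := fun _ : Fin 2 => ℝ) 0)

lemma coordFst_apply (e f x : Fin 2 → ℝ) :
    coordFst e f x = (cross e f)⁻¹ * (f 1 * x 0 - f 0 * x 1) := by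
  simp [coordFst]

lemma coordSnd_apply (e f x : Fin 2 → ℝ) :
    coordSnd e f x = (cross e f)⁻¹ * (e 0 * x 1 - e 1 * x 0) := by
  simp [coordSnd]

section Coordinates

variable {e f : Fin 2 → ℝ}

lemma coordFst_add (h : cross e f ≠ 0) (p q : ℝ) : coordFst e f (p • e + q • f) = p := by
  rw [coordFst_apply, inv_mul_eq_iff_eq_mul₀ h]
  simp [cross]; ring

lemma coordSnd_add (h : cross e f ≠ 0) (p q : ℝ) : coordSnd e f (p • e + q • f) = q := by
  rw [coordSnd_apply, inv_mul_eq_iff_eq_mul₀ h]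
  simp [cross]; ring

lemma coord_decomposition (h : cross e f ≠ 0) (x : Fin 2 → ℝ) :
    x = coordFst e f x • e + coordSnd e f x • f := by
  ext i
  fin_cases i <;> simp only [coordFst_apply, coordSnd_apply, cross] at h ⊢ <;> simp <;>
    field_simp <;> ring

end Coordinates

/-- On the cone spanned by an outer vertex `e` and an inner vertex `f`, the continuous map which
is affine on the four regions cut out by the lines through the edges at `e` and `f`. -/
def wedgeMap (R : Matrix (Fin 2) (Fin 2) ℝ) (r : ℝ) (e f x : Fin 2 → ℝ) : Fin 2 → ℝ :=
  x + (max (1 - (coordFst e f + ((1 + r ^ 2) / 2) • coordSnd e f) x) 0 -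
      max (1 - (coordFst e f + coordSnd e f) x) 0) • ((2 / (1 - r ^ 2)) • (R *ᵥ f - f)) +
    (max (1 - (coordFst e f + coordSnd e f) x) 0 -
      max (1 - (((1 + r ^ 2) / (2 * r ^ 2)) • coordFst e f + coordSnd e f) x) 0) •
        ((2 * r ^ 2 / (1 - r ^ 2)) • (R *ᵥ e - e))

section WedgeMap

variable {R : Matrix (Fin 2) (Fin 2) ℝ} {r : ℝ} {e f : Fin 2 → ℝ}

lemma wedgeMap_zero : wedgeMap R r e f 0 = 0 := by
  simp [wedgeMap]

lemma exists_lipschitzWith_posPart (l : (Fin 2 → ℝ) →L[ℝ] ℝ) :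
    ∃ K, LipschitzWith K fun x => max (1 - l x) 0 :=
  ⟨_, ((LipschitzWith.const (1 : ℝ)).sub l.lipschitz).max_const 0⟩

lemma exists_lipschitzWith_wedgeMap (R : Matrix (Fin 2) (Fin 2) ℝ) (r : ℝ) (e f : Fin 2 → ℝ) :
    ∃ K, LipschitzWith K (wedgeMap R r e f) := by
  have smul_vec {g : (Fin 2 → ℝ) → ℝ} {K : NNReal} (hg : LipschitzWith K g) (v : Fin 2 → ℝ) :
      LipschitzWith (‖ContinuousLinearMap.toSpanSingleton ℝ v‖₊ * K) fun x => g x • v :=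
    (ContinuousLinearMap.toSpanSingleton ℝ v).lipschitz.comp hg
  obtain ⟨K1, h1⟩ :=
    exists_lipschitzWith_posPart (coordFst e f + ((1 + r ^ 2) / 2) • coordSnd e f)
  obtain ⟨K2, h2⟩ := exists_lipschitzWith_posPart (coordFst e f + coordSnd e f)
  obtain ⟨K3, h3⟩ :=
    exists_lipschitzWith_posPart (((1 + r ^ 2) / (2 * r ^ 2)) • coordFst e f + coordSnd e f)
  exact ⟨_, (LipschitzWith.id.add (smul_vec (h1.sub h2) _)).add (smul_vec (h2.sub h3) _)⟩

lemma wedgeMap_combination (h : cross e f ≠ 0) (p q : ℝ) :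
    wedgeMap R r e f (p • e + q • f) = (p • e + q • f) +
      (max (1 - (p + (1 + r ^ 2) / 2 * q)) 0 - max (1 - (p + q)) 0) •
        ((2 / (1 - r ^ 2)) • (R *ᵥ f - f)) +
      (max (1 - (p + q)) 0 - max (1 - ((1 + r ^ 2) / (2 * r ^ 2) * p + q)) 0) •
        ((2 * r ^ 2 / (1 - r ^ 2)) • (R *ᵥ e - e)) := by
  simp only [wedgeMap, _root_.add_apply, _root_.smul_apply,
    coordFst_add h, coordSnd_add h, smul_eq_mul]

variable (h : cross e f ≠ 0) (hr0 : 0 < r) (hr1 : r < 1) {p q : ℝ}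
include h hr0 hr1

lemma wedgeMap_outside (hp : 0 ≤ p) (hq : 0 ≤ q) (h1 : 1 ≤ p + (1 + r ^ 2) / 2 * q) :
    wedgeMap R r e f (p • e + q • f) = p • e + q • f := by
  have k0 : (1 + r ^ 2) / 2 ≤ 1 := by nlinarith
  have k1 : 1 ≤ (1 + r ^ 2) / (2 * r ^ 2) := by rw [le_div_iff₀ (by positivity)]; nlinarith
  rw [wedgeMap_combination h, max_eq_right (by linarith), max_eq_right (by nlinarith),
    max_eq_right (by nlinarith)]
  simp

lemma wedgeMap_even (hp : 0 ≤ p) (h1 : p + (1 + r ^ 2) / 2 * q ≤ 1) (h2 : 1 ≤ p + q) :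
    wedgeMap R r e f (p • e + q • f) = (p • e + q • f) +
      (1 - (p + (1 + r ^ 2) / 2 * q)) • ((2 / (1 - r ^ 2)) • (R *ᵥ f - f)) := by
  have k1 : 1 ≤ (1 + r ^ 2) / (2 * r ^ 2) := by rw [le_div_iff₀ (by positivity)]; nlinarith
  rw [wedgeMap_combination h, max_eq_left (by linarith), max_eq_right (by linarith),
    max_eq_right (by nlinarith)]
  simp

lemma wedgeMap_odd (hq : 0 ≤ q) (h1 : p + q ≤ 1) (h2 : 1 ≤ (1 + r ^ 2) / (2 * r ^ 2) * p + q) :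
    wedgeMap R r e f (p • e + q • f) = R *ᵥ (p • e + q • f) +
      (1 - ((1 + r ^ 2) / (2 * r ^ 2) * p + q)) •
        ((2 * r ^ 2 / (1 - r ^ 2)) • (R *ᵥ e - e)) := by
  have k0 : (1 + r ^ 2) / 2 ≤ 1 := by nlinarith
  have k2 : 1 - r ^ 2 ≠ 0 := by nlinarith
  rw [wedgeMap_combination h, max_eq_left (by nlinarith), max_eq_left (by linarith),
    max_eq_right (by linarith), Matrix.mulVec_add, Matrix.mulVec_smul, Matrix.mulVec_smul]
  ext i
  simp only [Pi.add_apply, Pi.sub_apply, Pi.smul_apply, smul_eq_mul]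
  field_simp
  ring

lemma wedgeMap_inside (hp : 0 ≤ p) (hq : 0 ≤ q) (h1 : (1 + r ^ 2) / (2 * r ^ 2) * p + q ≤ 1) :
    wedgeMap R r e f (p • e + q • f) = R *ᵥ (p • e + q • f) := by
  have k0 : (1 + r ^ 2) / 2 ≤ 1 := by nlinarith
  have k1 : 1 ≤ (1 + r ^ 2) / (2 * r ^ 2) := by rw [le_div_iff₀ (by positivity)]; nlinarith
  have k2 : 1 - r ^ 2 ≠ 0 := by nlinarith
  rw [wedgeMap_combination h, max_eq_left (by nlinarith), max_eq_left (by nlinarith),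
    max_eq_left (by linarith), Matrix.mulVec_add, Matrix.mulVec_smul, Matrix.mulVec_smul]
  ext i
  simp only [Pi.add_apply, Pi.sub_apply, Pi.smul_apply, smul_eq_mul]
  field_simp
  ring

end WedgeMap

/-- Adjacent wedges with a common outer vertex agree on the ray through it. -/
lemma wedgeMap_smul_left {e f f' : Fin 2 → ℝ} (h : cross e f ≠ 0) (h' : cross e f' ≠ 0)
    (R : Matrix (Fin 2) (Fin 2) ℝ) (r t : ℝ) :
    wedgeMap R r e f (t • e) = wedgeMap R r e f' (t • e) := by
  have key (g : Fin 2 → ℝ) (hg : cross e g ≠ 0) := wedgeMap_combination (R := R) (r := r) hg t 0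
  have k1 := key f h
  have k2 := key f' h'
  simp only [zero_smul, add_zero, mul_zero, sub_self] at k1 k2
  rw [k1, k2]

/-- Adjacent wedges with a common inner vertex agree on the ray through it. -/
lemma wedgeMap_smul_right {e e' f : Fin 2 → ℝ} (h : cross e f ≠ 0) (h' : cross e' f ≠ 0)
    (R : Matrix (Fin 2) (Fin 2) ℝ) (r t : ℝ) :
    wedgeMap R r e f (t • f) = wedgeMap R r e' f (t • f) := by
  have key (g : Fin 2 → ℝ) (hg : cross g f ≠ 0) := wedgeMap_combination (R := R) (r := r) hg 0 t
  have k1 := key e h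
  have k2 := key e' h'
  simp only [zero_smul, zero_add, mul_zero, sub_self, add_zero] at k1 k2
  rw [k1, k2]

/-- The parameters of a single-layer construction: `s` is half the central angle, `d` half the
rotation angle of the inner polygon and `r` its circumradius. -/
structure IsContiData (n : ℕ) (s d r : ℝ) : Prop where
  three_le : 3 ≤ n
  mul_eq : n * s = π
  neg_lt : -s < d
  lt : d < s
  pos : 0 < r
  lt_one : r < 1
  radius : 2 * r * Real.cos d = (1 + r ^ 2) * Real.cos s

/-- The outer vertices. -/
def outer (s : ℝ) (k : ℤ) : Fin 2 → ℝ := dir (2 * s * k)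

/-- The inner vertices. -/
def inner (s d r : ℝ) (k : ℤ) : Fin 2 → ℝ := r • dir (2 * s * k + (s - d))

namespace IsContiData

variable {n : ℕ} {s d r : ℝ} (H : IsContiData n s d r)
include H

lemma n_pos : (0 : ℝ) < n := by
  have := H.three_le
  exact_mod_cast (by omega : 0 < n)

lemma s_pos : 0 < s := by
  have h := H.n_pos
  have : 0 < n * s := by rw [H.mul_eq]; exact Real.pi_pos
  exact pos_of_mul_pos_right this h.le

lemma three_mul_s_le : 3 * s ≤ π := by
  have h : (3 : ℝ) ≤ n := by exact_mod_cast H.three_le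
  rw [← H.mul_eq]
  exact mul_le_mul_of_nonneg_right h H.s_pos.le

lemma cos_s_pos : 0 < Real.cos s :=
  Real.cos_pos_of_mem_Ioo ⟨by linarith [H.s_pos, Real.pi_pos],
    by linarith [H.three_mul_s_le, Real.pi_pos]⟩

lemma sin_pos {t : ℝ} (h0 : 0 < t) (h1 : t ≤ 2 * s) : 0 < Real.sin t :=
  Real.sin_pos_of_pos_of_lt_pi h0 (by linarith [H.three_mul_s_le, H.s_pos])

lemma outer_add_mul (k m : ℤ) : outer s (k + n * m) = outer s k := by
  rw [outer, outer, ← dir_add_int_mul_two_pi (2 * s * k) m, ← H.mul_eq]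
  congr 1
  push_cast
  ring

lemma inner_add_mul (k m : ℤ) : inner s d r (k + n * m) = inner s d r k := by
  rw [inner, inner, ← dir_add_int_mul_two_pi (2 * s * k + (s - d)) m, ← H.mul_eq]
  congr 2
  push_cast
  ring

lemma outer_emod (k : ℤ) : outer s (k % n) = outer s k := by
  conv_rhs => rw [← Int.emod_add_mul_ediv k n]
  rw [H.outer_add_mul]

lemma inner_emod (k : ℤ) : inner s d r (k % n) = inner s d r k := by
  conv_rhs => rw [← Int.emod_add_mul_ediv k n]
  rw [H.inner_add_mul]

end IsContiData

lemma cross_outer_inner (s d r : ℝ) (k : ℤ) :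
    cross (outer s k) (inner s d r k) = r * Real.sin (s - d) := by
  have h := Real.sin_sub (2 * s * k + (s - d)) (2 * s * k)
  rw [add_sub_cancel_left] at h
  rw [h]
  simp [cross, outer, inner]
  ring

lemma cross_outer_add_one_inner (s d r : ℝ) (k : ℤ) :
    cross (outer s (k + 1)) (inner s d r k) = -(r * Real.sin (s + d)) := by
  have h := Real.sin_sub (2 * s * k + (s - d)) (2 * s * (k + 1))
  rw [show 2 * s * (k : ℝ) + (s - d) - 2 * s * (k + 1) = -(s + d) by ring, Real.sin_neg] at h
  rw [← mul_neg, h]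
  simp [cross, outer, inner]
  ring

/-- A pair consisting of an outer vertex and a neighbouring inner vertex. -/
def IsWedge (s d r : ℝ) (e f : Fin 2 → ℝ) : Prop :=
  ∃ k : ℤ, f = inner s d r k ∧ (e = outer s k ∨ e = outer s (k + 1))

/-- The interpolation map at the point with polar coordinates `(ρ, θ)`. -/
def polarMap (s d r ρ θ : ℝ) : Fin 2 → ℝ :=
  if θ - 2 * s * ⌊θ / (2 * s)⌋ ≤ s - d then
    wedgeMap (Qrot (2 * d)) r (outer s ⌊θ / (2 * s)⌋) (inner s d r ⌊θ / (2 * s)⌋) (ρ • dir θ)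
  else
    wedgeMap (Qrot (2 * d)) r (outer s (⌊θ / (2 * s)⌋ + 1)) (inner s d r ⌊θ / (2 * s)⌋)
      (ρ • dir θ)

lemma polarMap_zero (s d r θ : ℝ) : polarMap s d r 0 θ = 0 := by
  simp [polarMap, wedgeMap_zero]

/-- The single-layer interpolation map. -/
def contiMap (s d r : ℝ) (x : Fin 2 → ℝ) : Fin 2 → ℝ :=
  polarMap s d r ‖(⟨x 0, x 1⟩ : ℂ)‖ (Complex.arg ⟨x 0, x 1⟩)

namespace IsContiData

variable {n : ℕ} {s d r : ℝ} (H : IsContiData n s d r)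
include H

lemma cross_ne_zero {e f : Fin 2 → ℝ} (h : IsWedge s d r e f) : cross e f ≠ 0 := by
  have := H.neg_lt
  have := H.lt
  obtain ⟨k, rfl, rfl | rfl⟩ := h
  · rw [cross_outer_inner]
    exact (mul_pos H.pos (H.sin_pos (by linarith) (by linarith))).ne'
  · rw [cross_outer_add_one_inner]
    exact (neg_neg_of_pos (mul_pos H.pos (H.sin_pos (by linarith) (by linarith)))).ne

lemma polarMap_add (ρ θ : ℝ) (m : ℤ) :
    polarMap s d r ρ (θ + m * (2 * π)) = polarMap s d r ρ θ := by
  have hs := H.s_pos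
  have h1 : (θ + m * (2 * π)) / (2 * s) = θ / (2 * s) + ((n * m : ℤ) : ℝ) := by
    rw [← H.mul_eq]
    push_cast
    field_simp
  have h2 : θ + m * (2 * π) - 2 * s * ((⌊θ / (2 * s)⌋ + n * m : ℤ) : ℝ) =
      θ - 2 * s * ⌊θ / (2 * s)⌋ := by
    rw [← H.mul_eq]
    push_cast
    ring
  simp only [polarMap]
  rw [h1, Int.floor_add_intCast, h2, H.outer_add_mul, H.inner_add_mul, add_right_comm,
    H.outer_add_mul, dir_add_int_mul_two_pi]

lemma polarMap_of_left (ρ : ℝ) {θ : ℝ} {k : ℤ} (h0 : 2 * s * k ≤ θ)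
    (h1 : θ ≤ 2 * s * k + (s - d)) :
    polarMap s d r ρ θ =
      wedgeMap (Qrot (2 * d)) r (outer s k) (inner s d r k) (ρ • dir θ) := by
  have hs := H.s_pos
  have := H.neg_lt
  have hk : ⌊θ / (2 * s)⌋ = k := by
    rw [Int.floor_eq_iff, le_div_iff₀ (by linarith), div_lt_iff₀ (by linarith)]
    constructor <;> linarith
  rw [polarMap, hk, if_pos (by linarith)]

lemma polarMap_of_right (ρ : ℝ) {θ : ℝ} {k : ℤ} (h0 : 2 * s * k + (s - d) ≤ θ)
    (h1 : θ ≤ 2 * s * (k + 1)) :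
    polarMap s d r ρ θ =
      wedgeMap (Qrot (2 * d)) r (outer s (k + 1)) (inner s d r k) (ρ • dir θ) := by
  have hs := H.s_pos
  have hlt := H.lt
  have hneg := H.neg_lt
  have hw0 : ∀ j, cross (outer s j) (inner s d r j) ≠ 0 :=
    fun j => H.cross_ne_zero ⟨j, rfl, Or.inl rfl⟩
  have hw1 : ∀ j, cross (outer s (j + 1)) (inner s d r j) ≠ 0 :=
    fun j => H.cross_ne_zero ⟨j, rfl, Or.inr rfl⟩
  rcases h1.eq_or_lt with h1 | h1
  · have hk : 2 * s * ((k + 1 : ℤ) : ℝ) = θ := by rw [h1]; push_cast; ring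
    rw [H.polarMap_of_left ρ (k := k + 1) hk.le (by linarith)]
    have hθ : dir θ = outer s (k + 1) := by rw [outer, hk]
    rw [hθ]
    exact wedgeMap_smul_left (hw0 _) (hw1 _) _ _ _
  rcases h0.eq_or_lt with h0 | h0
  · rw [H.polarMap_of_left ρ (k := k) (by linarith) h0.ge]
    have hθ : ρ • dir θ = (ρ / r) • inner s d r k := by
      rw [inner, smul_smul, div_mul_cancel₀ _ H.pos.ne', h0]
    rw [hθ]
    exact wedgeMap_smul_right (hw0 _) (hw1 _) _ _ _
  · have hk : ⌊θ / (2 * s)⌋ = k := by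
      rw [Int.floor_eq_iff, le_div_iff₀ (by linarith), div_lt_iff₀ (by linarith)]
      constructor <;> linarith
    rw [polarMap, hk, if_neg (by linarith)]

lemma contiMap_smul_dir {ρ : ℝ} (hρ : 0 ≤ ρ) (θ : ℝ) :
    contiMap s d r (ρ • dir θ) = polarMap s d r ρ θ := by
  have hz : (⟨(ρ • dir θ) 0, (ρ • dir θ) 1⟩ : ℂ) =
      ρ * (Complex.cos θ + Complex.sin θ * Complex.I) := by
    apply Complex.ext <;> simp [← Complex.ofReal_cos, ← Complex.ofReal_sin]
  rw [contiMap, hz]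
  rcases hρ.eq_or_lt with rfl | hρ
  · simp [polarMap_zero]
  · rw [Complex.arg_mul_cos_add_sin_mul_I_eq_toIocMod hρ, norm_mul,
      Complex.norm_cos_add_sin_mul_I, mul_one, Complex.norm_real, Real.norm_of_nonneg hρ.le]
    conv_rhs => rw [← toIocMod_add_toIocDiv_zsmul Real.two_pi_pos (-π) θ]
    rw [zsmul_eq_mul, H.polarMap_add]

lemma contiMap_eq_wedgeMap {e f : Fin 2 → ℝ} (h : IsWedge s d r e f) {p q : ℝ} (hp : 0 ≤ p)
    (hq : 0 ≤ q) :
    contiMap s d r (p • e + q • f) = wedgeMap (Qrot (2 * d)) r e f (p • e + q • f) := by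
  have hs := H.s_pos
  have hlt := H.lt
  have hneg := H.neg_lt
  have hs3 := H.three_mul_s_le
  obtain ⟨k, rfl, rfl | rfl⟩ := h
  · obtain ⟨ρ, θ, hρ, h1, h2, hx⟩ := exists_dir_of_cone (φ := 2 * s * k)
      (ψ := 2 * s * k + (s - d)) (by linarith) (by linarith) hp (mul_nonneg hq H.pos.le)
    rw [show p • outer s k + q • inner s d r k = ρ • dir θ by
      rw [outer, inner, smul_smul, hx], H.contiMap_smul_dir hρ, H.polarMap_of_left ρ h1 h2]
  · obtain ⟨ρ, θ, hρ, h1, h2, hx⟩ := exists_dir_of_cone (φ := 2 * s * k + (s - d))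
      (ψ := 2 * s * (k + 1)) (by linarith) (by linarith) (mul_nonneg hq H.pos.le) hp
    rw [show p • outer s (k + 1) + q • inner s d r k = ρ • dir θ by
      rw [outer, inner, smul_smul, add_comm, ← hx]; push_cast; rfl, H.contiMap_smul_dir hρ,
      H.polarMap_of_right ρ h1 h2]

lemma exists_wedge (x : Fin 2 → ℝ) : ∃ e f, IsWedge s d r e f ∧
    ∃ p q : ℝ, 0 ≤ p ∧ 0 ≤ q ∧ x = p • e + q • f := by
  have hs := H.s_pos
  have hlt := H.lt
  have hneg := H.neg_lt
  have hr := H.pos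
  obtain ⟨ρ, θ, hρ, -, -, rfl⟩ := exists_eq_smul_dir x
  obtain ⟨k, hk⟩ : ∃ k : ℤ, ⌊θ / (2 * s)⌋ = k := ⟨_, rfl⟩
  rw [Int.floor_eq_iff, le_div_iff₀ (by linarith), div_lt_iff₀ (by linarith)] at hk
  have nonneg {t : ℝ} (h0 : 0 ≤ t) (h1 : t ≤ 2 * s) : 0 ≤ Real.sin t :=
    Real.sin_nonneg_of_nonneg_of_le_pi h0 (by linarith [H.three_mul_s_le])
  rcases le_total θ (2 * s * k + (s - d)) with h | h
  · have hS := H.sin_pos (t := s - d) (by linarith) (by linarith)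
    refine ⟨_, _, ⟨k, rfl, Or.inl rfl⟩, ρ * Real.sin (2 * s * k + (s - d) - θ) / Real.sin (s - d),
      ρ * Real.sin (θ - 2 * s * k) / (r * Real.sin (s - d)), ?_, ?_, ?_⟩
    · exact div_nonneg (mul_nonneg hρ (nonneg (by linarith) (by linarith))) hS.le
    · exact div_nonneg (mul_nonneg hρ (nonneg (by linarith) (by linarith))) (by positivity)
    · have := dir_interpolation (2 * s * k) θ (2 * s * k + (s - d))
      rw [add_sub_cancel_left] at this
      rw [outer, inner, smul_smul, show dir θ = (Real.sin (s - d))⁻¹ • Real.sin (s - d) • dir θ by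
        rw [smul_smul, inv_mul_cancel₀ hS.ne', one_smul], this]
      simp only [smul_add, smul_smul]
      congr 2 <;> field_simp
  · have hS := H.sin_pos (t := s + d) (by linarith) (by linarith)
    refine ⟨_, _, ⟨k, rfl, Or.inr rfl⟩, ρ * Real.sin (θ - (2 * s * k + (s - d))) / Real.sin (s + d),
      ρ * Real.sin (2 * s * (k + 1) - θ) / (r * Real.sin (s + d)), ?_, ?_, ?_⟩
    · exact div_nonneg (mul_nonneg hρ (nonneg (by linarith) (by linarith))) hS.le
    · exact div_nonneg (mul_nonneg hρ (nonneg (by linarith) (by linarith))) (by positivity)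
    · have := dir_interpolation (2 * s * k + (s - d)) θ (2 * s * (k + 1))
      rw [show 2 * s * ((k : ℝ) + 1) - (2 * s * k + (s - d)) = s + d by ring] at this
      rw [outer, inner, smul_smul, show dir θ = (Real.sin (s + d))⁻¹ • Real.sin (s + d) • dir θ by
        rw [smul_smul, inv_mul_cancel₀ hS.ne', one_smul], this, add_comm (Real.sin _ • dir _)]
      simp only [smul_add, smul_smul]
      push_cast
      congr 2 <;> field_simp

lemma finite_isWedge : {w : (Fin 2 → ℝ) × (Fin 2 → ℝ) | IsWedge s d r w.1 w.2}.Finite := by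
  have hn : (0 : ℤ) < n := by have := H.three_le; omega
  refine (((Set.finite_Ico (0 : ℤ) n).image (outer s)).prod
    ((Set.finite_Ico (0 : ℤ) n).image (inner s d r))).subset ?_
  have ho (k : ℤ) : outer s k ∈ outer s '' Set.Ico (0 : ℤ) n :=
    ⟨k % n, ⟨Int.emod_nonneg _ hn.ne', Int.emod_lt_of_pos _ hn⟩, H.outer_emod k⟩
  have hi (k : ℤ) : inner s d r k ∈ inner s d r '' Set.Ico (0 : ℤ) n :=
    ⟨k % n, ⟨Int.emod_nonneg _ hn.ne', Int.emod_lt_of_pos _ hn⟩, H.inner_emod k⟩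
  rintro ⟨e, f⟩ ⟨k, hf, he⟩
  simp only at hf he
  subst hf
  rcases he with rfl | rfl
  · exact ⟨ho k, hi k⟩
  · exact ⟨ho _, hi k⟩

end IsContiData
/-- A continuous map that is Lipschitz on each of finitely many closed sets covering the space
is Lipschitz. -/
lemma lipschitzWith_of_finite_closed_cover {ι V W : Type*} [Finite ι] [NormedAddCommGroup V]
    [NormedSpace ℝ V] [NormedAddCommGroup W] {g : V → W} {S : ι → Set V} {K : NNReal}
    (hclosed : ∀ i, IsClosed (S i)) (hcover : ∀ x, ∃ i, x ∈ S i)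
    (hg : ∀ i, LipschitzOnWith K g (S i)) : LipschitzWith K g := by
  have hcont : Continuous g :=
    (locallyFinite_of_finite S).continuous (Set.iUnion_eq_univ_iff.2 hcover) hclosed
      fun i => (hg i).continuousOn
  refine LipschitzWith.of_dist_le_mul fun x y => ?_
  let γ : ℝ → V := AffineMap.lineMap x y
  have hγ : Continuous γ := AffineMap.lineMap_continuous
  have hdist (t t' : ℝ) (h : t ≤ t') : dist (γ t) (γ t') = (t' - t) * dist x y := by
    rw [dist_lineMap_lineMap, dist_comm, Real.dist_eq, abs_of_nonneg (by linarith)]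
  let A : Set ℝ := {t | dist (g x) (g (γ t)) ≤ K * (t * dist x y)}
  have hA : IsClosed (A ∩ Set.Icc 0 1) :=
    (isClosed_le (by fun_prop) (by fun_prop)).inter isClosed_Icc
  have h1 : (1 : ℝ) ∈ A := by
    refine hA.mem_of_ge_of_forall_exists_gt (by simp [A, γ]) zero_le_one ?_
    rintro t ⟨htA, ht0, ht1⟩
    have hfreq : ∃ i, ∃ᶠ t' in nhdsWithin t (Set.Ioi t), γ t' ∈ S i := by
      by_contra! hne
      have hall : ∀ᶠ t' in nhdsWithin t (Set.Ioi t), ∀ i, γ t' ∉ S i :=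
        Filter.eventually_all.2 hne
      obtain ⟨t', ht'⟩ := hall.exists
      obtain ⟨i, hi⟩ := hcover (γ t')
      exact ht' i hi
    obtain ⟨i, hi⟩ := hfreq
    have htS : γ t ∈ S i :=
      ((hclosed i).preimage hγ).mem_of_frequently_of_tendsto hi
        (Filter.tendsto_id.mono_left nhdsWithin_le_nhds)
    obtain ⟨t', ht'S, ht't, ht'1⟩ := (hi.and_eventually (Ioc_mem_nhdsGT ht1)).exists
    refine ⟨t', ?_, ht't, ht'1⟩
    have h2 := (hg i).dist_le_mul _ htS _ ht'S
    rw [hdist t t' ht't.le] at h2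
    calc dist (g x) (g (γ t')) ≤ dist (g x) (g (γ t)) + dist (g (γ t)) (g (γ t')) :=
          dist_triangle _ _ _
      _ ≤ K * (t * dist x y) + K * ((t' - t) * dist x y) := add_le_add htA h2
      _ = K * (t' * dist x y) := by ring
  simpa [A, γ] using h1

namespace IsContiData

variable {n : ℕ} {s d r : ℝ} (H : IsContiData n s d r)
include H

lemma exists_lipschitzWith_contiMap : ∃ K, LipschitzWith K (contiMap s d r) := by
  let ι := {w : (Fin 2 → ℝ) × (Fin 2 → ℝ) | IsWedge s d r w.1 w.2}
  have : Fintype ι := H.finite_isWedge.fintype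
  choose K hK using fun w : ι => exists_lipschitzWith_wedgeMap (Qrot (2 * d)) r w.1.1 w.1.2
  refine ⟨∑ w, K w, lipschitzWith_of_finite_closed_cover (ι := ι)
    (S := fun w => {x | 0 ≤ coordFst w.1.1 w.1.2 x ∧ 0 ≤ coordSnd w.1.1 w.1.2 x}) ?_ ?_ ?_⟩
  · intro w
    exact (isClosed_Ici.preimage (coordFst w.1.1 w.1.2).continuous).inter
      (isClosed_Ici.preimage (coordSnd w.1.1 w.1.2).continuous)
  · intro x
    obtain ⟨e, f, hef, p, q, hp, hq, rfl⟩ := H.exists_wedge x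
    have h := H.cross_ne_zero hef
    refine ⟨⟨(e, f), hef⟩, ?_⟩
    simpa [coordFst_add h, coordSnd_add h] using ⟨hp, hq⟩
  · intro w
    have hle : K w ≤ ∑ w, K w := Finset.single_le_sum (fun _ _ => zero_le) (Finset.mem_univ w)
    have heq : ∀ x, 0 ≤ coordFst w.1.1 w.1.2 x ∧ 0 ≤ coordSnd w.1.1 w.1.2 x →
        contiMap s d r x = wedgeMap (Qrot (2 * d)) r w.1.1 w.1.2 x := by
      rintro x ⟨hp, hq⟩
      have h := H.contiMap_eq_wedgeMap w.2 hp hq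
      rwa [← coord_decomposition (H.cross_ne_zero w.2)] at h
    intro x hx y hy
    rw [heq x hx, heq y hy]
    exact (hK w).weaken hle x y

end IsContiData
lemma dir_dotProduct_dir (a b : ℝ) : dir a ⬝ᵥ dir b = Real.cos (a - b) := by
  simp [dotProduct, Fin.sum_univ_two, Real.cos_sub]

lemma convex_dotProduct_le (w : Fin 2 → ℝ) (c : ℝ) : Convex ℝ {x : Fin 2 → ℝ | w ⬝ᵥ x ≤ c} :=
  convex_halfSpace_le ⟨fun x y => dotProduct_add w x y, fun t x => dotProduct_smul t w x⟩ c

lemma exists_of_mem_convexHull_triple {V : Type*} [AddCommGroup V] [Module ℝ V] {u v w x : V}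
    (hx : x ∈ convexHull ℝ ({u, v, w} : Set V)) :
    ∃ a b c : ℝ, 0 ≤ a ∧ 0 ≤ b ∧ 0 ≤ c ∧ a + b + c = 1 ∧ x = a • u + b • v + c • w := by
  rw [convexHull_insert (Set.insert_nonempty _ _), convexHull_pair, mem_convexJoin] at hx
  obtain ⟨y, rfl, z, ⟨b, c, hb, hc, hbc, rfl⟩, ⟨a, t, ha, ht, hat, rfl⟩⟩ := hx
  refine ⟨a, t * b, t * c, ha, mul_nonneg ht hb, mul_nonneg ht hc, ?_, by module⟩
  rw [add_assoc, ← mul_add, hbc, mul_one, hat]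

lemma even_triangle_cases {V : Type*} [AddCommGroup V] [Module ℝ V] {e e' f : V} {p q : ℝ}
    (hp : 0 < p) (hq : 0 < q) (hpq : p + q ≤ 1) (hf : f = p • e + q • e') {x : V}
    (hx : x ∈ convexHull ℝ ({e, f, e'} : Set V)) :
    (∃ a b : ℝ, 0 ≤ a ∧ 0 ≤ b ∧ x = a • e + b • f ∧ a + (p + q) * b ≤ 1 ∧ 1 ≤ a + b) ∨
      ∃ a b : ℝ, 0 ≤ a ∧ 0 ≤ b ∧ x = a • e' + b • f ∧ a + (p + q) * b ≤ 1 ∧ 1 ≤ a + b := by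
  obtain ⟨a, b, c, ha, hb, hc, h1, rfl⟩ := exists_of_mem_convexHull_triple hx
  rcases le_total (c * p) (a * q) with h | h
  · have he' : e' = q⁻¹ • f - (p / q) • e := by
      rw [hf]; match_scalars <;> field_simp
      ring
    have hcq : 0 ≤ c / q := by positivity
    refine Or.inl ⟨a - c * p / q, b + c / q, ?_, by positivity, ?_, ?_, ?_⟩
    · rw [sub_nonneg, div_le_iff₀ hq]; exact h
    · rw [he']; match_scalars <;> field_simp
      ring
    · have : a - c * p / q + (p + q) * (b + c / q) = a + (p + q) * b + c := by field_simp; ring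
      nlinarith
    · have : a - c * p / q + (b + c / q) = a + b + (c / q) * (1 - p) := by field_simp; ring
      have h2 : c / q * q = c := div_mul_cancel₀ _ hq.ne'
      nlinarith
  · have he : e = p⁻¹ • f - (q / p) • e' := by
      rw [hf]; match_scalars <;> field_simp
      ring
    have hap : 0 ≤ a / p := by positivity
    refine Or.inr ⟨c - a * q / p, b + a / p, ?_, by positivity, ?_, ?_, ?_⟩
    · rw [sub_nonneg, div_le_iff₀ hp]; exact h
    · rw [he]; match_scalars <;> field_simp <;> ring
    · have : c - a * q / p + (p + q) * (b + a / p) = c + (p + q) * b + a := by field_simp; ring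
      nlinarith
    · have : c - a * q / p + (b + a / p) = c + b + (a / p) * (1 - q) := by field_simp; ring
      have h2 : a / p * p = a := div_mul_cancel₀ _ hp.ne'
      nlinarith

lemma odd_triangle_cases {V : Type*} [AddCommGroup V] [Module ℝ V] {e f f' : V} {p q : ℝ}
    (hp : 0 < p) (hq : 0 < q) (hpq : 1 ≤ p + q) (he : e = p • f + q • f') {x : V}
    (hx : x ∈ convexHull ℝ ({e, f, f'} : Set V)) :
    (∃ a b : ℝ, 0 ≤ a ∧ 0 ≤ b ∧ x = a • e + b • f ∧ a + b ≤ 1 ∧ 1 ≤ (p + q) * a + b) ∨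
      ∃ a b : ℝ, 0 ≤ a ∧ 0 ≤ b ∧ x = a • e + b • f' ∧ a + b ≤ 1 ∧ 1 ≤ (p + q) * a + b := by
  obtain ⟨a, b, c, ha, hb, hc, h1, rfl⟩ := exists_of_mem_convexHull_triple hx
  rcases le_total (c * p) (b * q) with h | h
  · have hf' : f' = q⁻¹ • e - (p / q) • f := by
      rw [he]; match_scalars <;> field_simp
      ring
    have hcq : 0 ≤ c / q := by positivity
    have h2 : c / q * q = c := div_mul_cancel₀ _ hq.ne'
    refine Or.inl ⟨a + c / q, b - c * p / q, by positivity, ?_, ?_, ?_, ?_⟩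
    · rw [sub_nonneg, div_le_iff₀ hq]; exact h
    · rw [hf']; match_scalars <;> field_simp
      ring
    · have : a + c / q + (b - c * p / q) = a + b + (c / q) * (1 - p) := by field_simp; ring
      nlinarith
    · have : (p + q) * (a + c / q) + (b - c * p / q) = (p + q) * a + b + c := by
        field_simp; ring
      nlinarith
  · have hf : f = p⁻¹ • e - (q / p) • f' := by
      rw [he]; match_scalars <;> field_simp
      ring
    have hbp : 0 ≤ b / p := by positivity
    have h2 : b / p * p = b := div_mul_cancel₀ _ hp.ne'
    refine Or.inr ⟨a + b / p, c - b * q / p, by positivity, ?_, ?_, ?_, ?_⟩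
    · rw [sub_nonneg, div_le_iff₀ hp]; exact h
    · rw [hf]; match_scalars <;> field_simp
      ring
    · have : a + b / p + (c - b * q / p) = a + c + (b / p) * (1 - q) := by field_simp; ring
      nlinarith
    · have : (p + q) * (a + b / p) + (c - b * q / p) = (p + q) * a + c + b := by
        field_simp; ring
      nlinarith

/-- The value at the origin of the interpolation map on an even triangle. -/
def evenVec (s d r : ℝ) (k : ℤ) : Fin 2 → ℝ :=
  (2 / (1 - r ^ 2)) • (Qrot (2 * d) *ᵥ inner s d r k - inner s d r k)

/-- The value at the origin of the interpolation map on an odd triangle. -/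
def oddVec (s d r : ℝ) (k : ℤ) : Fin 2 → ℝ :=
  (2 * r ^ 2 / (1 - r ^ 2)) • (Qrot (2 * d) *ᵥ outer s k - outer s k)

/-- The gradient of the interpolation map on an even triangle. -/
def evenGrad (s d r : ℝ) (k : ℤ) : Matrix (Fin 2) (Fin 2) ℝ :=
  1 - (Real.cos s)⁻¹ • vecMulVec (evenVec s d r k) (dir (2 * s * k + s))

/-- The gradient of the interpolation map on an odd triangle. -/
def oddGrad (s d r : ℝ) (k : ℤ) : Matrix (Fin 2) (Fin 2) ℝ :=
  Qrot (2 * d) - (r * Real.cos s)⁻¹ • vecMulVec (oddVec s d r k) (dir (2 * s * k - d))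

lemma evenGrad_mulVec (s d r : ℝ) (k : ℤ) (x : Fin 2 → ℝ) :
    evenGrad s d r k *ᵥ x =
      x - ((dir (2 * s * k + s) ⬝ᵥ x) / Real.cos s) • evenVec s d r k := by
  rw [evenGrad, Matrix.sub_mulVec, Matrix.one_mulVec, Matrix.smul_mulVec,
    Matrix.vecMulVec_mulVec]
  ext i
  simp
  ring

lemma oddGrad_mulVec (s d r : ℝ) (k : ℤ) (x : Fin 2 → ℝ) :
    oddGrad s d r k *ᵥ x = Qrot (2 * d) *ᵥ x -
      ((dir (2 * s * k - d) ⬝ᵥ x) / (r * Real.cos s)) • oddVec s d r k := by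
  rw [oddGrad, Matrix.sub_mulVec, Matrix.smul_mulVec, Matrix.vecMulVec_mulVec]
  ext i
  simp
  ring

lemma sin_sub_add_sin_add (s d : ℝ) :
    Real.sin (s - d) + Real.sin (s + d) = 2 * Real.sin s * Real.cos d := by
  rw [Real.sin_sub, Real.sin_add]; ring

namespace IsContiData

variable {n : ℕ} {s d r : ℝ} (H : IsContiData n s d r)
include H

lemma outer_dotProduct_even {k : ℤ} {e : Fin 2 → ℝ} (he : e = outer s k ∨ e = outer s (k + 1))
    (p q : ℝ) : dir (2 * s * k + s) ⬝ᵥ (p • e + q • inner s d r k) =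
      (p + (1 + r ^ 2) / 2 * q) * Real.cos s := by
  have h1 : dir (2 * s * k + s) ⬝ᵥ e = Real.cos s := by
    rcases he with rfl | rfl <;> rw [outer, dir_dotProduct_dir]
    · congr 1; ring
    · rw [← Real.cos_neg]; congr 1; push_cast; ring
  have h2 : dir (2 * s * k + s) ⬝ᵥ inner s d r k = r * Real.cos d := by
    rw [inner, dotProduct_smul, dir_dotProduct_dir, smul_eq_mul]
    congr 2; ring
  rw [dotProduct_add, dotProduct_smul, dotProduct_smul, h1, h2, smul_eq_mul, smul_eq_mul]
  linear_combination (q / 2) * H.radius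

lemma inner_dotProduct_odd {k : ℤ} {f : Fin 2 → ℝ}
    (hf : f = inner s d r (k - 1) ∨ f = inner s d r k) (p q : ℝ) :
    dir (2 * s * k - d) ⬝ᵥ (p • outer s k + q • f) =
      ((1 + r ^ 2) / (2 * r ^ 2) * p + q) * (r * Real.cos s) := by
  have hr := H.pos
  have h1 : dir (2 * s * k - d) ⬝ᵥ f = r * Real.cos s := by
    rcases hf with rfl | rfl <;>
      rw [inner, dotProduct_smul, dir_dotProduct_dir, smul_eq_mul]
    · congr 2; push_cast; ring
    · rw [← Real.cos_neg]; congr 2; ring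
  have h2 : dir (2 * s * k - d) ⬝ᵥ outer s k = Real.cos d := by
    rw [outer, dir_dotProduct_dir, ← Real.cos_neg]
    congr 1; ring
  rw [dotProduct_add, dotProduct_smul, dotProduct_smul, h1, h2, smul_eq_mul, smul_eq_mul]
  field_simp
  linear_combination p * H.radius

lemma contiMap_outside {e f : Fin 2 → ℝ} (h : IsWedge s d r e f) {p q : ℝ} (hp : 0 ≤ p)
    (hq : 0 ≤ q) (h1 : 1 ≤ p + (1 + r ^ 2) / 2 * q) :
    contiMap s d r (p • e + q • f) = p • e + q • f := by
  rw [H.contiMap_eq_wedgeMap h hp hq,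
    wedgeMap_outside (H.cross_ne_zero h) H.pos H.lt_one hp hq h1]

lemma contiMap_inside {e f : Fin 2 → ℝ} (h : IsWedge s d r e f) {p q : ℝ} (hp : 0 ≤ p)
    (hq : 0 ≤ q) (h1 : (1 + r ^ 2) / (2 * r ^ 2) * p + q ≤ 1) :
    contiMap s d r (p • e + q • f) = Qrot (2 * d) *ᵥ (p • e + q • f) := by
  rw [H.contiMap_eq_wedgeMap h hp hq,
    wedgeMap_inside (H.cross_ne_zero h) H.pos H.lt_one hp hq h1]

lemma contiMap_even {k : ℤ} {e : Fin 2 → ℝ} (he : e = outer s k ∨ e = outer s (k + 1))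
    {p q : ℝ} (hp : 0 ≤ p) (hq : 0 ≤ q) (h1 : p + (1 + r ^ 2) / 2 * q ≤ 1) (h2 : 1 ≤ p + q) :
    contiMap s d r (p • e + q • inner s d r k) =
      evenGrad s d r k *ᵥ (p • e + q • inner s d r k) + evenVec s d r k := by
  have hw : IsWedge s d r e (inner s d r k) := ⟨k, rfl, he⟩
  rw [H.contiMap_eq_wedgeMap hw hp hq,
    wedgeMap_even (H.cross_ne_zero hw) H.pos H.lt_one hp h1 h2, evenGrad_mulVec,
    H.outer_dotProduct_even he, mul_div_cancel_right₀ _ H.cos_s_pos.ne', ← evenVec]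
  module

lemma contiMap_odd {k : ℤ} {f : Fin 2 → ℝ} (hf : f = inner s d r (k - 1) ∨ f = inner s d r k)
    {p q : ℝ} (hp : 0 ≤ p) (hq : 0 ≤ q) (h1 : p + q ≤ 1)
    (h2 : 1 ≤ (1 + r ^ 2) / (2 * r ^ 2) * p + q) :
    contiMap s d r (p • outer s k + q • f) =
      oddGrad s d r k *ᵥ (p • outer s k + q • f) + oddVec s d r k := by
  have hw : IsWedge s d r (outer s k) f := by
    rcases hf with rfl | rfl
    · exact ⟨k - 1, rfl, Or.inr (by rw [sub_add_cancel])⟩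
    · exact ⟨k, rfl, Or.inl rfl⟩
  rw [H.contiMap_eq_wedgeMap hw hp hq,
    wedgeMap_odd (H.cross_ne_zero hw) H.pos H.lt_one hq h1 h2, oddGrad_mulVec,
    H.inner_dotProduct_odd hf, mul_div_cancel_right₀ _ (mul_pos H.pos H.cos_s_pos).ne',
    ← oddVec]
  module

lemma inner_eq : ∃ p q : ℝ, 0 < p ∧ 0 < q ∧ p + q = (1 + r ^ 2) / 2 ∧
    ∀ k, inner s d r k = p • outer s k + q • outer s (k + 1) := by
  have hs := H.s_pos
  have := H.lt
  have := H.neg_lt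
  have hr := H.pos
  have h1 := H.sin_pos (t := s - d) (by linarith) (by linarith)
  have h2 := H.sin_pos (t := s + d) (by linarith) (by linarith)
  have h3 := H.sin_pos (t := 2 * s) (by linarith) le_rfl
  refine ⟨r * Real.sin (s + d) / Real.sin (2 * s), r * Real.sin (s - d) / Real.sin (2 * s),
    by positivity, by positivity, ?_, fun k => ?_⟩
  · rw [← add_div, div_eq_iff h3.ne', Real.sin_two_mul, ← mul_add, add_comm (Real.sin (s + d)),
      sin_sub_add_sin_add]
    linear_combination Real.sin s * H.radius
  · have h := dir_interpolation (2 * s * k) (2 * s * k + (s - d)) (2 * s * (k + 1))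
    rw [show 2 * s * ((k : ℝ) + 1) - 2 * s * k = 2 * s by ring,
      show 2 * s * ((k : ℝ) + 1) - (2 * s * k + (s - d)) = s + d by ring,
      add_sub_cancel_left] at h
    rw [inner, outer, outer, show dir (2 * s * k + (s - d)) =
      (Real.sin (2 * s))⁻¹ • Real.sin (2 * s) • dir (2 * s * k + (s - d)) by
        rw [smul_smul, inv_mul_cancel₀ h3.ne', one_smul], h]
    push_cast
    module

lemma outer_eq : ∃ p q : ℝ, 0 < p ∧ 0 < q ∧ p + q = (1 + r ^ 2) / (2 * r ^ 2) ∧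
    ∀ k, outer s k = p • inner s d r (k - 1) + q • inner s d r k := by
  have hs := H.s_pos
  have := H.lt
  have := H.neg_lt
  have hr := H.pos
  have h1 := H.sin_pos (t := s - d) (by linarith) (by linarith)
  have h2 := H.sin_pos (t := s + d) (by linarith) (by linarith)
  have h3 := H.sin_pos (t := 2 * s) (by linarith) le_rfl
  refine ⟨Real.sin (s - d) / (r * Real.sin (2 * s)), Real.sin (s + d) / (r * Real.sin (2 * s)),
    by positivity, by positivity, ?_, fun k => ?_⟩
  · rw [← add_div, sin_sub_add_sin_add, div_eq_div_iff (by positivity) (by positivity),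
      Real.sin_two_mul]
    linear_combination 2 * r * Real.sin s * H.radius
  · have h := dir_interpolation (2 * s * (k - 1) + (s - d)) (2 * s * k) (2 * s * k + (s - d))
    rw [show 2 * s * (k : ℝ) + (s - d) - (2 * s * (k - 1) + (s - d)) = 2 * s by ring,
      show 2 * s * (k : ℝ) - (2 * s * (k - 1) + (s - d)) = s + d by ring,
      add_sub_cancel_left] at h
    rw [inner, inner, outer, show dir (2 * s * k) =
      (Real.sin (2 * s))⁻¹ • Real.sin (2 * s) • dir (2 * s * k) by
        rw [smul_smul, inv_mul_cancel₀ h3.ne', one_smul], h]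
    push_cast
    match_scalars <;> field_simp

lemma contiMap_of_mem_even_triangle {k : ℤ} {x : Fin 2 → ℝ}
    (hx : x ∈ convexHull ℝ {outer s k, inner s d r k, outer s (k + 1)}) :
    contiMap s d r x = evenGrad s d r k *ᵥ x + evenVec s d r k := by
  obtain ⟨p, q, hp, hq, hpq, hf⟩ := H.inner_eq
  have hr := H.pos
  have hr1 := H.lt_one
  rcases even_triangle_cases hp hq (by rw [hpq]; nlinarith) (hf k) hx with h | h <;>
    obtain ⟨a, b, ha, hb, rfl, h1, h2⟩ := h <;> rw [hpq] at h1
  · exact H.contiMap_even (Or.inl rfl) ha hb h1 h2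
  · exact H.contiMap_even (Or.inr rfl) ha hb h1 h2

lemma contiMap_of_mem_odd_triangle {k : ℤ} {x : Fin 2 → ℝ}
    (hx : x ∈ convexHull ℝ {outer s k, inner s d r (k - 1), inner s d r k}) :
    contiMap s d r x = oddGrad s d r k *ᵥ x + oddVec s d r k := by
  obtain ⟨p, q, hp, hq, hpq, he⟩ := H.outer_eq
  have hr := H.pos
  have hr1 := H.lt_one
  have h1 : 1 ≤ p + q := by rw [hpq, le_div_iff₀ (by positivity)]; nlinarith
  rcases odd_triangle_cases hp hq h1 (he k) hx with h | h <;>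
    obtain ⟨a, b, ha, hb, rfl, h1, h2⟩ := h <;> rw [hpq] at h2
  · exact H.contiMap_odd (Or.inl rfl) ha hb h1 h2
  · exact H.contiMap_odd (Or.inr rfl) ha hb h1 h2

end IsContiData
lemma _root_.Convex.smul_add_smul_mem {V : Type*} [AddCommGroup V] [Module ℝ V] {S : Set V}
    (hS : Convex ℝ S) (h0 : (0 : V) ∈ S) {u v : V} (hu : u ∈ S) (hv : v ∈ S) {p q : ℝ}
    (hp : 0 ≤ p) (hq : 0 ≤ q) (hpq : p + q ≤ 1) : p • u + q • v ∈ S := by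
  rcases (add_nonneg hp hq).eq_or_lt with h | h
  · rw [show p = 0 by linarith, show q = 0 by linarith]
    simpa using h0
  · have hm := hS.smul_mem_of_zero_mem h0
      (hS hu hv (div_nonneg hp h.le) (div_nonneg hq h.le) (by rw [← add_div, div_self h.ne']))
      ⟨h.le, hpq⟩
    rwa [smul_add, smul_smul, smul_smul, mul_div_cancel₀ _ h.ne', mul_div_cancel₀ _ h.ne'] at hm

lemma zero_mem_convexHull_range {V : Type*} [AddCommGroup V] [Module ℝ V] {g : ℤ → V} {n : ℕ}
    (hn : n ≠ 0) (hg : ∑ k ∈ Finset.range n, g k = 0) :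
    (0 : V) ∈ convexHull ℝ (Set.range g) := by
  have h := (convex_convexHull ℝ (Set.range g)).sum_mem (t := Finset.range n)
    (w := fun _ => (n : ℝ)⁻¹) (z := fun k : ℕ => g k) (fun _ _ => by positivity)
    (by simp [hn]) (fun k _ => subset_convexHull ℝ _ ⟨k, rfl⟩)
  rwa [← Finset.smul_sum, hg, smul_zero] at h

lemma _root_.Convex.ae_mem_interior {V : Type*} [NormedAddCommGroup V] [NormedSpace ℝ V]
    [MeasurableSpace V] [BorelSpace V] [FiniteDimensional ℝ V] (μ : Measure V)
    [μ.IsAddHaarMeasure] {S : Set V} (hS : Convex ℝ S) : ∀ᵐ x ∂μ, x ∈ S → x ∈ interior S := by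
  filter_upwards [measure_eq_zero_iff_ae_notMem.1 (hS.addHaar_frontier μ)] with x hx hxS
  by_contra h
  exact hx ⟨subset_closure hxS, h⟩

lemma hasFDerivAt_of_eqOn_affine {g : (Fin 2 → ℝ) → Fin 2 → ℝ}
    {M : Matrix (Fin 2) (Fin 2) ℝ} {b x : Fin 2 → ℝ} {S : Set (Fin 2 → ℝ)}
    (hS : ∀ y ∈ S, g y = M *ᵥ y + b) (hx : x ∈ interior S) :
    HasFDerivAt g (Matrix.mulVecLin M).toContinuousLinearMap x := by
  have h : HasFDerivAt (fun y => M *ᵥ y + b) (Matrix.mulVecLin M).toContinuousLinearMap x :=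
    (Matrix.mulVecLin M).toContinuousLinearMap.hasFDerivAt.add_const b
  refine h.congr_of_eventuallyEq ?_
  filter_upwards [mem_interior_iff_mem_nhds.1 hx] with y hy using hS y hy

lemma two_mul_sin_smul_dir (s t : ℝ) :
    (2 * Real.sin s) • dir t = dir (t + s - π / 2) - dir (t - s - π / 2) := by
  ext i
  fin_cases i <;>
    simp [Real.sin_add, Real.sin_sub, Real.cos_add, Real.cos_sub] <;> ring

/-- The part of the cone over a wedge lying in the even triangle. -/
def evenPiece (r : ℝ) (e f : Fin 2 → ℝ) : Set (Fin 2 → ℝ) :=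
  {x | 0 ≤ coordFst e f x} ∩ {x | 0 ≤ coordSnd e f x} ∩
    {x | (coordFst e f + ((1 + r ^ 2) / 2) • coordSnd e f) x ≤ 1} ∩
      {x | 1 ≤ (coordFst e f + coordSnd e f) x}

/-- The part of the cone over a wedge lying in the odd triangle. -/
def oddPiece (r : ℝ) (e f : Fin 2 → ℝ) : Set (Fin 2 → ℝ) :=
  {x | 0 ≤ coordFst e f x} ∩ {x | 0 ≤ coordSnd e f x} ∩
    {x | (coordFst e f + coordSnd e f) x ≤ 1} ∩
      {x | 1 ≤ (((1 + r ^ 2) / (2 * r ^ 2)) • coordFst e f + coordSnd e f) x}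

lemma convex_evenPiece (r : ℝ) (e f : Fin 2 → ℝ) : Convex ℝ (evenPiece r e f) := by
  have hle (l : (Fin 2 → ℝ) →L[ℝ] ℝ) (c : ℝ) : Convex ℝ {x | l x ≤ c} :=
    convex_halfSpace_le l.toLinearMap.isLinear c
  have hge (l : (Fin 2 → ℝ) →L[ℝ] ℝ) (c : ℝ) : Convex ℝ {x | c ≤ l x} :=
    convex_halfSpace_ge l.toLinearMap.isLinear c
  exact (((hge _ _).inter (hge _ _)).inter (hle _ _)).inter (hge _ _)

lemma convex_oddPiece (r : ℝ) (e f : Fin 2 → ℝ) : Convex ℝ (oddPiece r e f) := by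
  have hle (l : (Fin 2 → ℝ) →L[ℝ] ℝ) (c : ℝ) : Convex ℝ {x | l x ≤ c} :=
    convex_halfSpace_le l.toLinearMap.isLinear c
  have hge (l : (Fin 2 → ℝ) →L[ℝ] ℝ) (c : ℝ) : Convex ℝ {x | c ≤ l x} :=
    convex_halfSpace_ge l.toLinearMap.isLinear c
  exact (((hge _ _).inter (hge _ _)).inter (hle _ _)).inter (hge _ _)

lemma add_mem_evenPiece {r : ℝ} {e f : Fin 2 → ℝ} (h : cross e f ≠ 0) {p q : ℝ} (hp : 0 ≤ p)
    (hq : 0 ≤ q) (h1 : p + (1 + r ^ 2) / 2 * q ≤ 1) (h2 : 1 ≤ p + q) :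
    p • e + q • f ∈ evenPiece r e f := by
  simp only [evenPiece, Set.mem_inter_iff, Set.mem_ofPred_eq, _root_.add_apply,
    _root_.smul_apply, coordFst_add h, coordSnd_add h, smul_eq_mul]
  exact ⟨⟨⟨hp, hq⟩, h1⟩, h2⟩

lemma add_mem_oddPiece {r : ℝ} {e f : Fin 2 → ℝ} (h : cross e f ≠ 0) {p q : ℝ} (hp : 0 ≤ p)
    (hq : 0 ≤ q) (h1 : p + q ≤ 1) (h2 : 1 ≤ (1 + r ^ 2) / (2 * r ^ 2) * p + q) :
    p • e + q • f ∈ oddPiece r e f := by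
  simp only [oddPiece, Set.mem_inter_iff, Set.mem_ofPred_eq, _root_.add_apply,
    _root_.smul_apply, coordFst_add h, coordSnd_add h, smul_eq_mul]
  exact ⟨⟨⟨hp, hq⟩, h1⟩, h2⟩

lemma IsWedge.exists_odd {s d r : ℝ} {e f : Fin 2 → ℝ} (h : IsWedge s d r e f) :
    ∃ k : ℤ, e = outer s k ∧ (f = inner s d r (k - 1) ∨ f = inner s d r k) := by
  obtain ⟨k, rfl, rfl | rfl⟩ := h
  · exact ⟨k, rfl, Or.inr rfl⟩
  · exact ⟨k + 1, rfl, Or.inl (by rw [add_sub_cancel_right])⟩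

namespace IsContiData

variable {n : ℕ} {s d r : ℝ} (H : IsContiData n s d r)
include H

lemma cos_odd_mul_le (m : ℤ) : Real.cos ((2 * m + 1) * s) ≤ Real.cos s := by
  have hn : (0 : ℤ) < n := by have := H.three_le; omega
  have hs := H.s_pos
  have h0 : (0 : ℝ) ≤ (m % n : ℤ) := by exact_mod_cast Int.emod_nonneg m hn.ne'
  have h1 : ((m % n : ℤ) : ℝ) + 1 ≤ n := by exact_mod_cast Int.emod_lt_of_pos m hn
  have hm : (m : ℝ) = (m % n : ℤ) + n * (m / n : ℤ) := by
    exact_mod_cast (Int.emod_add_mul_ediv m n).symm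
  have hns := H.mul_eq
  generalize ((m % n : ℤ) : ℝ) = i at *
  rw [hm, show (2 * (i + n * ((m / n : ℤ) : ℝ)) + 1) * s =
    (2 * i + 1) * s + (m / n : ℤ) * (2 * π) by rw [← hns]; ring, Real.cos_add_int_mul_two_pi]
  rcases le_total ((2 * i + 1) * s) π with h | h
  · exact Real.cos_le_cos_of_nonneg_of_le_pi hs.le h (by nlinarith)
  · rw [← Real.cos_two_pi_sub]
    exact Real.cos_le_cos_of_nonneg_of_le_pi hs.le (by linarith) (by nlinarith)

lemma dotProduct_le_of_mem_outer {x : Fin 2 → ℝ} (hx : x ∈ convexHull ℝ (Set.range (outer s)))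
    (k : ℤ) : dir (2 * s * k + s) ⬝ᵥ x ≤ Real.cos s := by
  refine convexHull_min ?_ (convex_dotProduct_le (dir (2 * s * k + s)) (Real.cos s)) hx
  rintro _ ⟨j, rfl⟩
  rw [Set.mem_ofPred_eq, outer, dir_dotProduct_dir]
  convert H.cos_odd_mul_le (k - j) using 2
  push_cast
  ring

lemma dotProduct_le_of_mem_inner {x : Fin 2 → ℝ}
    (hx : x ∈ convexHull ℝ (Set.range (inner s d r))) (k : ℤ) :
    dir (2 * s * k - d) ⬝ᵥ x ≤ r * Real.cos s := by
  refine convexHull_min ?_ (convex_dotProduct_le (dir (2 * s * k - d)) (r * Real.cos s)) hx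
  rintro _ ⟨j, rfl⟩
  rw [Set.mem_ofPred_eq, inner, dotProduct_smul, dir_dotProduct_dir, smul_eq_mul]
  refine mul_le_mul_of_nonneg_left ?_ H.pos.le
  have h : 2 * s * k - d - (2 * s * j + (s - d)) = (2 * (k - j - 1 : ℤ) + 1) * s := by
    push_cast
    ring
  rw [h]
  exact H.cos_odd_mul_le _

lemma sum_dir (c : ℝ) : ∑ k ∈ Finset.range n, dir (2 * s * k + c) = 0 := by
  have hs : 2 * Real.sin s ≠ 0 :=
    (mul_pos two_pos (H.sin_pos H.s_pos (by linarith [H.s_pos]))).ne'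
  rw [← smul_eq_zero_iff_right hs, Finset.smul_sum]
  have h (k : ℕ) : (2 * Real.sin s) • dir (2 * s * k + c) =
      dir (2 * s * (k + 1 : ℕ) + c - s - π / 2) - dir (2 * s * k + c - s - π / 2) := by
    rw [two_mul_sin_smul_dir]
    congr 2
    push_cast
    ring
  simp_rw [h]
  rw [Finset.sum_range_sub (fun k : ℕ => dir (2 * s * k + c - s - π / 2)), sub_eq_zero,
    ← dir_add_int_mul_two_pi (2 * s * (0 : ℕ) + c - s - π / 2) 1]
  congr 1
  push_cast
  linear_combination 2 * H.mul_eq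

lemma zero_mem_outer : 0 ∈ convexHull ℝ (Set.range (outer s)) := by
  refine zero_mem_convexHull_range (n := n) (by have := H.three_le; omega) ?_
  simpa [outer] using H.sum_dir 0

lemma zero_mem_inner : 0 ∈ convexHull ℝ (Set.range (inner s d r)) := by
  refine zero_mem_convexHull_range (n := n) (by have := H.three_le; omega) ?_
  simp_rw [inner, ← Finset.smul_sum, Int.cast_natCast, H.sum_dir, smul_zero]

lemma mem_outer {e f : Fin 2 → ℝ} (h : IsWedge s d r e f) {p q : ℝ} (hp : 0 ≤ p) (hq : 0 ≤ q)
    (h1 : p + (1 + r ^ 2) / 2 * q ≤ 1) : p • e + q • f ∈ convexHull ℝ (Set.range (outer s)) := by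
  obtain ⟨a, b, ha, hb, hab, hf⟩ := H.inner_eq
  rw [← hab] at h1
  have hv (k : ℤ) : outer s k ∈ convexHull ℝ (Set.range (outer s)) :=
    subset_convexHull ℝ _ ⟨k, rfl⟩
  obtain ⟨k, rfl, he⟩ := h
  have hg : (a + b)⁻¹ • inner s d r k ∈ convexHull ℝ (Set.range (outer s)) := by
    rw [hf, smul_add, smul_smul, smul_smul]
    exact convex_convexHull ℝ _ (hv k) (hv (k + 1)) (by positivity) (by positivity)
      (by field_simp)
  have he' : e ∈ convexHull ℝ (Set.range (outer s)) := by
    rcases he with rfl | rfl <;> exact hv _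
  have hm := (convex_convexHull ℝ _).smul_add_smul_mem H.zero_mem_outer he' hg hp
    (mul_nonneg (add_pos ha hb).le hq) h1
  rwa [smul_smul, mul_right_comm, mul_inv_cancel₀ (add_pos ha hb).ne', one_mul] at hm

lemma mem_inner {e f : Fin 2 → ℝ} (h : IsWedge s d r e f) {p q : ℝ} (hp : 0 ≤ p) (hq : 0 ≤ q)
    (h1 : (1 + r ^ 2) / (2 * r ^ 2) * p + q ≤ 1) :
    p • e + q • f ∈ convexHull ℝ (Set.range (inner s d r)) := by
  obtain ⟨a, b, ha, hb, hab, he⟩ := H.outer_eq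
  rw [← hab] at h1
  have hv (k : ℤ) : inner s d r k ∈ convexHull ℝ (Set.range (inner s d r)) :=
    subset_convexHull ℝ _ ⟨k, rfl⟩
  obtain ⟨k, rfl, hf⟩ := h.exists_odd
  have hg : (a + b)⁻¹ • outer s k ∈ convexHull ℝ (Set.range (inner s d r)) := by
    rw [he, smul_add, smul_smul, smul_smul]
    exact convex_convexHull ℝ _ (hv (k - 1)) (hv k) (by positivity) (by positivity)
      (by field_simp)
  have hf' : f ∈ convexHull ℝ (Set.range (inner s d r)) := by
    rcases hf with rfl | rfl <;> exact hv _
  have hm := (convex_convexHull ℝ _).smul_add_smul_mem H.zero_mem_inner hg hf'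
    (mul_nonneg (add_pos ha hb).le hp) hq h1
  rwa [smul_smul, mul_right_comm, mul_inv_cancel₀ (add_pos ha hb).ne', one_mul] at hm

lemma le_one_of_mem_outer {e f : Fin 2 → ℝ} (h : IsWedge s d r e f) {p q : ℝ}
    (hx : p • e + q • f ∈ convexHull ℝ (Set.range (outer s))) :
    p + (1 + r ^ 2) / 2 * q ≤ 1 := by
  obtain ⟨k, rfl, he⟩ := h
  have h1 := H.dotProduct_le_of_mem_outer hx k
  rw [H.outer_dotProduct_even he] at h1
  exact le_of_mul_le_mul_right (by linarith) H.cos_s_pos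

lemma le_one_of_mem_inner {e f : Fin 2 → ℝ} (h : IsWedge s d r e f) {p q : ℝ}
    (hx : p • e + q • f ∈ convexHull ℝ (Set.range (inner s d r))) :
    (1 + r ^ 2) / (2 * r ^ 2) * p + q ≤ 1 := by
  obtain ⟨k, rfl, hf⟩ := h.exists_odd
  have h1 := H.dotProduct_le_of_mem_inner hx k
  rw [H.inner_dotProduct_odd hf] at h1
  exact le_of_mul_le_mul_right (by linarith) (mul_pos H.pos H.cos_s_pos)

lemma contiMap_of_notMem_outer {x : Fin 2 → ℝ}
    (hx : x ∉ convexHull ℝ (Set.range (outer s))) : contiMap s d r x = x := by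
  obtain ⟨e, f, h, p, q, hp, hq, rfl⟩ := H.exists_wedge x
  exact H.contiMap_outside h hp hq (le_of_not_ge fun h1 => hx (H.mem_outer h hp hq h1))

lemma contiMap_of_mem_inner {x : Fin 2 → ℝ}
    (hx : x ∈ convexHull ℝ (Set.range (inner s d r))) :
    contiMap s d r x = Qrot (2 * d) *ᵥ x := by
  obtain ⟨e, f, h, p, q, hp, hq, rfl⟩ := H.exists_wedge x
  exact H.contiMap_inside h hp hq (H.le_one_of_mem_inner h hx)

lemma ae_hasFDerivAt_contiMap :
    ∀ᵐ x ∂(volume.restrict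
      (convexHull ℝ (Set.range (outer s)) \ convexHull ℝ (Set.range (inner s d r)))),
      ∃ k : ℤ, ∃ M, (M = evenGrad s d r k ∨ M = oddGrad s d r k) ∧
        HasFDerivAt (contiMap s d r) (Matrix.mulVecLin M).toContinuousLinearMap x := by
  rw [ae_restrict_iff'₀ (((convex_convexHull ℝ _).nullMeasurableSet _).diff
    ((convex_convexHull ℝ _).nullMeasurableSet _))]
  have h1 := (ae_ball_iff H.finite_isWedge.countable).2 fun w _ =>
    (convex_evenPiece r w.1 w.2).ae_mem_interior volume
  have h2 := (ae_ball_iff H.finite_isWedge.countable).2 fun w _ =>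
    (convex_oddPiece r w.1 w.2).ae_mem_interior volume
  filter_upwards [h1, h2] with x hx1 hx2 hx
  obtain ⟨e, f, h, p, q, hp, hq, rfl⟩ := H.exists_wedge x
  have hc := H.cross_ne_zero h
  have ho := H.le_one_of_mem_outer h hx.1
  have hi : 1 ≤ (1 + r ^ 2) / (2 * r ^ 2) * p + q :=
    le_of_not_ge fun h1 => hx.2 (H.mem_inner h hp hq h1)
  rcases le_total 1 (p + q) with hpq | hpq
  · obtain ⟨k, rfl, he⟩ := id h
    refine ⟨k, _, Or.inl rfl, hasFDerivAt_of_eqOn_affine (S := evenPiece r e _)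
      (b := evenVec s d r k) ?_ (hx1 ⟨e, _⟩ h ?_)⟩
    · rintro y ⟨⟨⟨y1, y2⟩, y3⟩, y4⟩
      rw [coord_decomposition hc y]
      exact H.contiMap_even he y1 y2 y3 y4
    · exact add_mem_evenPiece hc hp hq ho hpq
  · obtain ⟨k, rfl, hf⟩ := h.exists_odd
    refine ⟨k, _, Or.inr rfl, hasFDerivAt_of_eqOn_affine (S := oddPiece r _ f)
      (b := oddVec s d r k) ?_ (hx2 ⟨_, f⟩ h ?_)⟩
    · rintro y ⟨⟨⟨y1, y2⟩, y3⟩, y4⟩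
      rw [coord_decomposition hc y]
      exact H.contiMap_odd hf y1 y2 y3 y4
    · exact add_mem_oddPiece hc hp hq hpq hi

end IsContiData
lemma Qrot_add (a b : ℝ) : Qrot (a + b) = Qrot a * Qrot b := by
  ext i j
  fin_cases i <;> fin_cases j <;>
    simp [Qrot, Matrix.mul_apply, Fin.sum_univ_two, Real.cos_add, Real.sin_add] <;> ring

lemma Qrot_zero : Qrot 0 = 1 := by
  simp [Qrot, Matrix.one_fin_two]

lemma Qrot_transpose (θ : ℝ) : (Qrot θ)ᵀ = Qrot (-θ) := by
  ext i j
  fin_cases i <;> fin_cases j <;> simp [Qrot]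

lemma Qrot_mul_transpose (θ : ℝ) : Qrot θ * (Qrot θ)ᵀ = 1 := by
  rw [Qrot_transpose, ← Qrot_add, add_neg_cancel, Qrot_zero]

lemma Qrot_transpose_mul (θ : ℝ) : (Qrot θ)ᵀ * Qrot θ = 1 := by
  rw [Qrot_transpose, ← Qrot_add, neg_add_cancel, Qrot_zero]

lemma Qrot_add_int_mul_two_pi (θ : ℝ) (m : ℤ) : Qrot (θ + m * (2 * π)) = Qrot θ := by
  simp [Qrot, Real.cos_add_int_mul_two_pi, Real.sin_add_int_mul_two_pi]

lemma Qrot_mem_SO2 (θ : ℝ) : Qrot θ ∈ SO2 := by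
  refine ⟨Qrot_mul_transpose θ, ?_⟩
  rw [Qrot, Matrix.det_fin_two_of]
  linear_combination Real.sin_sq_add_cos_sq θ

lemma mul_mem_SO2 {R S : Matrix (Fin 2) (Fin 2) ℝ} (hR : R ∈ SO2) (hS : S ∈ SO2) :
    R * S ∈ SO2 := by
  refine ⟨?_, by rw [Matrix.det_mul, hR.2, hS.2, mul_one]⟩
  rw [Matrix.transpose_mul, Matrix.mul_assoc, ← Matrix.mul_assoc S, hS.1, Matrix.one_mul, hR.1]

lemma transpose_mem_SO2 {R : Matrix (Fin 2) (Fin 2) ℝ} (hR : R ∈ SO2) : Rᵀ ∈ SO2 :=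
  ⟨by rw [Matrix.transpose_transpose, mul_eq_one_comm, hR.1], by rw [Matrix.det_transpose, hR.2]⟩

lemma one_sub_smul_vecMulVec_dir (g ψ : ℝ) :
    1 - g • vecMulVec (dir (ψ + π / 2)) (dir ψ) =
      Qrot ψ * !![1, 0; -g, 1] * (Qrot ψ)ᵀ := by
  have h := Real.sin_sq_add_cos_sq ψ
  ext i j
  fin_cases i <;> fin_cases j <;>
    simp [Qrot, Matrix.mul_apply, Fin.sum_univ_two, vecMulVec_apply, Real.cos_add_pi_div_two,
      Real.sin_add_pi_div_two]
  · linear_combination -h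
  · ring
  · ring
  · linear_combination -h

lemma shear_mul (g x y : ℝ) :
    !![1, 0; -g, 1] * !![x, -y; y, x] = !![x, -y; y - g * x, x + g * y] := by
  ext i j
  fin_cases i <;> fin_cases j <;> simp [Matrix.mul_apply, Fin.sum_univ_two] <;> ring

lemma exists_SO2_mul {a t σ g x y N : ℝ} (ha : 0 < a) (hN : 0 < N) (hσ : σ ^ 2 = 1)
    (h0 : x ^ 2 + y ^ 2 = N) (h1 : x ^ 2 + (y - g * x) ^ 2 = a ^ 2 * N)
    (h2 : g * (y * (y - g * x) - x ^ 2) = σ * ((1 - a ^ 2) * t * N)) :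
    ∃ R ∈ SO2, (√N)⁻¹ • !![x, -y; y - g * x, x + g * y] =
      R * (!![1, 0; 0, σ] * !![a, (a⁻¹ - a) * t; 0, a⁻¹] * !![1, 0; 0, σ]) := by
  obtain ⟨m, hm, rfl⟩ : ∃ m : ℝ, 0 < m ∧ N = m ^ 2 := ⟨√N, by positivity, by simp [hN.le]⟩
  rw [Real.sqrt_sq hm.le]
  refine ⟨(a * m)⁻¹ • !![x, -(y - g * x); y - g * x, x], ⟨?_, ?_⟩, ?_⟩
  · ext i j
    fin_cases i <;> fin_cases j <;> simp [Matrix.mul_apply, Fin.sum_univ_two] <;> field_simp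
    · linear_combination h1
    · ring
    · ring
    · linear_combination h1
  · rw [Matrix.det_smul, Matrix.det_fin_two_of]
    simp
    field_simp
    linear_combination h1
  · ext i j
    fin_cases i <;> fin_cases j <;> simp [Matrix.mul_apply, Fin.sum_univ_two] <;> field_simp
    · apply mul_left_cancel₀ hN.ne'
      linear_combination y * h1 + x * h2 - m ^ 2 * (x * g - y) * hσ - (y - g * x) * h0
    · apply mul_left_cancel₀ hN.ne'
      linear_combination -(x + g * y) * h1 + (y - g * x) * h2 - m ^ 2 * x * hσ + x * h0

lemma Qrot_int_mul_mem_dihedral {n : ℕ} (hn : n ≠ 0) (m : ℤ) :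
    ∃ j : ℕ, j < n ∧ Qrot (m * (2 * π / n)) = Qrot (2 * π * j / n) := by
  have hn' : (0 : ℤ) < n := by omega
  obtain ⟨j, hj⟩ := Int.eq_ofNat_of_zero_le (Int.emod_nonneg m hn'.ne')
  refine ⟨j, by have := Int.emod_lt_of_pos m hn'; omega, ?_⟩
  have hm : (m : ℝ) = j + n * (m / n : ℤ) := by
    have := Int.emod_add_mul_ediv m n
    rw [hj] at this
    exact_mod_cast this.symm
  rw [← Qrot_add_int_mul_two_pi (2 * π * j / n) (m / n)]
  congr 1
  rw [hm]
  field_simp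

/-- The shear rate of the interpolation map. -/
def shearRate (s d r : ℝ) : ℝ := 4 * r * Real.sin d / ((1 - r ^ 2) * Real.cos s)

lemma dir_add_sub_dir_sub (ψ d : ℝ) :
    dir (ψ + d) - dir (ψ - d) = (2 * Real.sin d) • dir (ψ + π / 2) := by
  rw [two_mul_sin_smul_dir]
  congr 2 <;> ring

lemma evenGrad_eq (s d r : ℝ) (k : ℤ) :
    evenGrad s d r k = Qrot (2 * s * k + s) * !![1, 0; -shearRate s d r, 1] *
      (Qrot (2 * s * k + s))ᵀ := by
  have h : evenVec s d r k =
      (2 / (1 - r ^ 2) * r * (2 * Real.sin d)) • dir (2 * s * k + s + π / 2) := by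
    rw [evenVec, inner, Matrix.mulVec_smul, Qrot_mulVec_dir, ← smul_sub, mul_smul, mul_smul,
      ← dir_add_sub_dir_sub]
    congr 4 <;> ring
  rw [← one_sub_smul_vecMulVec_dir, evenGrad, h, smul_vecMulVec, smul_smul, shearRate]
  congr 2
  field_simp
  ring

lemma oddGrad_eq (s d : ℝ) {r : ℝ} (hr : r ≠ 0) (k : ℤ) :
    oddGrad s d r k = Qrot (2 * d) * (Qrot (2 * s * k - d) *
      !![1, 0; -shearRate s d r, 1] * (Qrot (2 * s * k - d))ᵀ) := by
  have h : oddVec s d r k =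
      (2 * r ^ 2 / (1 - r ^ 2) * (2 * Real.sin d)) •
        Qrot (2 * d) *ᵥ dir (2 * s * k - d + π / 2) := by
    rw [oddVec, outer, Qrot_mulVec_dir, Qrot_mulVec_dir, mul_smul,
      show 2 * d + (2 * s * (k : ℝ) - d + π / 2) = 2 * s * k + d + π / 2 by ring,
      ← dir_add_sub_dir_sub]
    congr 3 <;> ring
  rw [← one_sub_smul_vecMulVec_dir, oddGrad, h, smul_vecMulVec, smul_smul, shearRate,
    Matrix.mul_sub, Matrix.mul_one, Matrix.mul_smul, Matrix.mul_vecMulVec]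
  congr 2
  field_simp
  ring

/-- Every matrix of the form `!![x, -y; y, x]` commutes with rotations. -/
lemma commute_one_sub_smul_Qrot (r θ φ : ℝ) : Commute (Qrot φ) (1 - r • Qrot θ) :=
  (Commute.one_right _).sub_right (Commute.smul_right
    (by rw [Commute, SemiconjBy, ← Qrot_add, ← Qrot_add, add_comm]) r)

lemma Qrot_mul_one_sub_smul_Qrot (r φ θ ψ : ℝ) :
    Qrot φ * (1 - r • Qrot θ) = Qrot ψ * (Qrot (φ - ψ) - r • Qrot (φ + θ - ψ)) := by
  rw [Matrix.mul_sub, Matrix.mul_sub, Matrix.mul_one, Matrix.mul_smul, Matrix.mul_smul,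
    ← Qrot_add, ← Qrot_add, ← Qrot_add, add_sub_cancel, add_sub_cancel]

lemma exists_conjugate_dihedral {n : ℕ} (hn : n ≠ 0) {s σ : ℝ} (hs : n * s = π)
    (hσ : σ = 1 ∨ σ = -1) (k : ℤ) {B C D R V : Matrix (Fin 2) (Fin 2) ℝ} (hR : R ∈ SO2)
    (hB : B ∈ SO2) (hC : C = Qrot (2 * s * k) * B) (hcomm : Commute (Qrot (2 * s * k)) B)
    (hD : D * C = R * (!![1, 0; 0, σ] * V * !![1, 0; 0, σ])) :
    ∃ P ∈ (fun P => B * P * Bᵀ) '' dihedral n, ∃ R ∈ SO2, D = R * (P * (B * V * Bᵀ) * Pᵀ) := by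
  have hC2 : C ∈ SO2 := hC ▸ mul_mem_SO2 (Qrot_mem_SO2 _) hB
  have hBB : Bᵀ * B = 1 := by rw [mul_eq_one_comm, hB.1]
  have hn' : (n : ℝ) ≠ 0 := by exact_mod_cast hn
  have hang (m : ℤ) : m * (2 * π / n) = 2 * s * m := by rw [← hs]; field_simp
  have hP : Qrot (2 * s * k) * !![1, 0; 0, σ] ∈ dihedral n := by
    rcases hσ with rfl | rfl
    · obtain ⟨j, hj, h⟩ := Qrot_int_mul_mem_dihedral hn k
      rw [hang] at h
      refine Or.inl ⟨j, hj, ?_⟩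
      rw [← Matrix.one_fin_two, Matrix.mul_one, h]
    · obtain ⟨j, hj, h⟩ := Qrot_int_mul_mem_dihedral hn (-k)
      rw [hang, Int.cast_neg, mul_neg] at h
      refine Or.inr ⟨j, hj, ?_⟩
      rw [← h]
      ext i j
      fin_cases i <;> fin_cases j <;> simp [Qrot, Matrix.mul_apply, Fin.sum_univ_two]
  refine ⟨_, ⟨_, hP, rfl⟩, R * Cᵀ, mul_mem_SO2 hR (transpose_mem_SO2 hC2), ?_⟩
  have hSt : (!![1, 0; 0, σ] : Matrix (Fin 2) (Fin 2) ℝ)ᵀ = !![1, 0; 0, σ] := by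
    ext i j
    fin_cases i <;> fin_cases j <;> rfl
  generalize (!![1, 0; 0, σ] : Matrix (Fin 2) (Fin 2) ℝ) = S at *
  have hconj : B * (Qrot (2 * s * k) * S) * Bᵀ * (B * V * Bᵀ) *
      (B * (Qrot (2 * s * k) * S) * Bᵀ)ᵀ = C * (S * V * S) * Cᵀ := by
    have hBQ : C = B * Qrot (2 * s * k) := hC.trans hcomm.eq
    calc _ = B * Qrot (2 * s * k) * S * (Bᵀ * B) * V * (Bᵀ * B) * Sᵀ *
          (B * Qrot (2 * s * k))ᵀ := by
          simp only [Matrix.transpose_mul, Matrix.transpose_transpose, Matrix.mul_assoc]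
      _ = _ := by
          rw [hBB, hSt, ← hBQ, Matrix.mul_one, Matrix.mul_one]
          simp only [Matrix.mul_assoc]
  calc D = D * (C * Cᵀ) := by rw [hC2.1, Matrix.mul_one]
    _ = R * (S * V * S) * Cᵀ := by rw [← Matrix.mul_assoc, hD]
    _ = R * (Cᵀ * C) * (S * V * S) * Cᵀ := by
        rw [mul_eq_one_comm.1 hC2.1, Matrix.mul_one]
    _ = _ := by
        rw [hconj]
        simp only [Matrix.mul_assoc]

namespace IsContiData

variable {n : ℕ} {s d r : ℝ} (H : IsContiData n s d r)
include H

lemma one_sub_sq_pos : 0 < 1 - r ^ 2 := by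
  have := H.pos
  have := H.lt_one
  nlinarith

lemma shearRate_mul : shearRate s d r * (Real.cos s - r * Real.cos d) = 2 * r * Real.sin d := by
  have h1 := H.one_sub_sq_pos.ne'
  have h2 := H.cos_s_pos.ne'
  rw [shearRate, div_mul_eq_mul_div, div_eq_iff (mul_ne_zero h1 h2)]
  linear_combination (-2 * r * Real.sin d) * H.radius

lemma shearRate_mul' : shearRate s d r * (Real.cos d - r * Real.cos s) = 2 * Real.sin d := by
  have h1 := H.one_sub_sq_pos.ne'
  have h2 := H.cos_s_pos.ne'
  rw [shearRate, div_mul_eq_mul_div, div_eq_iff (mul_ne_zero h1 h2)]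
  linear_combination (2 * Real.sin d) * H.radius

lemma shearRate_mul_sq : shearRate s d r * (1 - r ^ 2) * Real.cos s = 4 * r * Real.sin d := by
  have h1 := H.one_sub_sq_pos.ne'
  have h2 := H.cos_s_pos.ne'
  rw [shearRate]
  field_simp

lemma edge_sq : 1 + r ^ 2 - 2 * r * Real.cos (s - d) =
    2 * r * Real.sin s * Real.sin (s - d) / Real.cos s := by
  rw [eq_div_iff H.cos_s_pos.ne']
  have h := Real.cos_sub s (s - d)
  rw [sub_sub_cancel] at h
  linear_combination -H.radius + 2 * r * h

lemma edge_sq' : 1 + r ^ 2 - 2 * r * Real.cos (s + d) =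
    2 * r * Real.sin s * Real.sin (s + d) / Real.cos s := by
  rw [eq_div_iff H.cos_s_pos.ne']
  have h := Real.cos_sub (s + d) s
  rw [add_sub_cancel_left] at h
  linear_combination -H.radius + 2 * r * h

end IsContiData
lemma smul_one_sub_smul_Qrot_mem_SO2 {r θ N : ℝ} (hN : 0 < N)
    (h : 1 + r ^ 2 - 2 * r * Real.cos θ = N) : (√N)⁻¹ • (1 - r • Qrot θ) ∈ SO2 := by
  have hsq := Real.sin_sq_add_cos_sq θ
  have hN2 := Real.sq_sqrt hN.le
  have hN0 : √N ≠ 0 := by positivity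
  have hM : 1 - r • Qrot θ = !![1 - r * Real.cos θ, r * Real.sin θ;
      -(r * Real.sin θ), 1 - r * Real.cos θ] := by
    ext i j
    fin_cases i <;> fin_cases j <;> simp [Qrot]
  rw [hM]
  refine ⟨?_, ?_⟩
  · ext i j
    fin_cases i <;> fin_cases j <;> simp [Matrix.mul_apply, Fin.sum_univ_two] <;> field_simp
    · linear_combination h - hN2 + r ^ 2 * hsq
    · ring
    · ring
    · linear_combination h - hN2 + r ^ 2 * hsq
  · rw [Matrix.det_smul, Matrix.det_fin_two_of]
    simp
    field_simp
    linear_combination h - hN2 + r ^ 2 * hsq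

lemma Qrot_sub_smul_Qrot (r θ φ : ℝ) : Qrot θ - r • Qrot φ =
    !![Real.cos θ - r * Real.cos φ, -(Real.sin θ - r * Real.sin φ);
      Real.sin θ - r * Real.sin φ, Real.cos θ - r * Real.cos φ] := by
  ext i j
  fin_cases i <;> fin_cases j <;> simp [Qrot]
  ring

lemma shear_conj_mul (g r c ψ φ θ : ℝ) :
    Qrot ψ * !![1, 0; -g, 1] * (Qrot ψ)ᵀ * (Qrot φ * c • (1 - r • Qrot θ)) =
      Qrot ψ * c • (!![1, 0; -g, 1] * (Qrot (φ - ψ) - r • Qrot (φ + θ - ψ))) := by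
  rw [Matrix.mul_smul, Qrot_mul_one_sub_smul_Qrot r φ θ ψ, Matrix.mul_smul, ← Matrix.mul_assoc,
    Matrix.mul_assoc _ (Qrot ψ)ᵀ, Qrot_transpose_mul, Matrix.mul_one, Matrix.mul_smul,
    Matrix.mul_assoc]

namespace IsContiData

variable {n : ℕ} {s d r : ℝ} (H : IsContiData n s d r)
include H

lemma exists_grad_eq {a : ℝ} (ha : a = √(Real.sin (s + d) / Real.sin (s - d)))
    {B : Matrix (Fin 2) (Fin 2) ℝ}
    (hB : B = (√(1 + r ^ 2 - 2 * r * Real.cos (s - d)))⁻¹ • (1 - r • Qrot (s - d))) {k : ℤ}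
    {M : Matrix (Fin 2) (Fin 2) ℝ} (hM : M = evenGrad s d r k ∨ M = oddGrad s d r k) :
    ∃ P ∈ (fun P => B * P * Bᵀ) '' dihedral n, ∃ R ∈ SO2,
      M = R * (P * (B * !![a, (a⁻¹ - a) * Real.tan s; 0, a⁻¹] * Bᵀ) * Pᵀ) := by
  have hs := H.s_pos
  have hlt := H.lt
  have hneg := H.neg_lt
  have hr := H.pos
  have hc := H.cos_s_pos
  have hss := H.sin_pos hs (by linarith)
  have h1 := H.sin_pos (t := s - d) (by linarith) (by linarith)
  have h2 := H.sin_pos (t := s + d) (by linarith) (by linarith)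
  have hn : n ≠ 0 := by have := H.three_le; omega
  have ha0 : 0 < a := by rw [ha]; positivity
  have ha2 : a ^ 2 * Real.sin (s - d) = Real.sin (s + d) := by
    rw [ha, Real.sq_sqrt (by positivity), div_mul_cancel₀ _ h1.ne']
  have hrad := H.radius
  have hg := H.shearRate_mul
  have hg' := H.shearRate_mul'
  have hg2 := H.shearRate_mul_sq
  have hN := H.edge_sq
  have hN0 : 0 < 1 + r ^ 2 - 2 * r * Real.cos (s - d) := by rw [hN]; positivity
  have hN' : 1 + r ^ 2 - 2 * r * Real.cos (s + d) =
      a ^ 2 * (1 + r ^ 2 - 2 * r * Real.cos (s - d)) := by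
    rw [hN, H.edge_sq', ← ha2]
    ring
  have ht : (1 - a ^ 2) * Real.tan s * (1 + r ^ 2 - 2 * r * Real.cos (s - d)) =
      -(shearRate s d r * (1 - r ^ 2) * Real.sin s ^ 2) := by
    rw [hN, Real.tan_eq_sin_div_cos]
    apply mul_left_cancel₀ hc.ne'
    field_simp
    linear_combination Real.cos s * hg2 - 2 * r * ha2 + 2 * r * Real.sin_sub s d -
      2 * r * Real.sin_add s d
  have hB2 : B ∈ SO2 := hB ▸ smul_one_sub_smul_Qrot_mem_SO2 hN0 rfl
  have hcomm : Commute (Qrot (2 * s * k)) B :=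
    hB ▸ (commute_one_sub_smul_Qrot r (s - d) (2 * s * k)).smul_right _
  have hsq := Real.sin_sq_add_cos_sq s
  have hdq := Real.sin_sq_add_cos_sq d
  have hsub := Real.cos_sub s d
  have hadd := Real.cos_add s d
  rcases hM with rfl | rfl
  · obtain ⟨R, hR, h⟩ := exists_SO2_mul (g := shearRate s d r) (x := Real.cos s - r * Real.cos d)
      (y := r * Real.sin d - Real.sin s) (σ := -1) (t := Real.tan s) ha0 hN0 (by norm_num)
      (by linear_combination hsq + r ^ 2 * hdq + 2 * r * hsub)
      (by rw [hg, ← hN']; linear_combination hsq + r ^ 2 * hdq + 2 * r * hadd)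
      (by
        rw [hg, ht]
        linear_combination shearRate s d r * (r ^ 2 * hsq - r ^ 2 * hdq + Real.cos s * hrad))
    refine exists_conjugate_dihedral hn H.mul_eq (Or.inr rfl) k
      (mul_mem_SO2 (Qrot_mem_SO2 (2 * s * k + s)) hR) hB2 rfl hcomm ?_
    rw [evenGrad_eq, hB, shear_conj_mul, Matrix.mul_assoc, ← h,
      show 2 * s * (k : ℝ) - (2 * s * k + s) = -s by ring,
      show 2 * s * (k : ℝ) + (s - d) - (2 * s * k + s) = -d by ring, Qrot_sub_smul_Qrot,
      Real.cos_neg, Real.cos_neg, Real.sin_neg, Real.sin_neg,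
      show -Real.sin s - r * -Real.sin d = r * Real.sin d - Real.sin s by ring, shear_mul]
  · obtain ⟨R, hR, h⟩ := exists_SO2_mul (g := shearRate s d r) (x := Real.cos d - r * Real.cos s)
      (y := Real.sin d - r * Real.sin s) (σ := 1) (t := Real.tan s) ha0 hN0 (by norm_num)
      (by linear_combination hdq + r ^ 2 * hsq + 2 * r * hsub)
      (by rw [hg', ← hN']; linear_combination hdq + r ^ 2 * hsq + 2 * r * hadd)
      (by
        rw [hg', ht]
        linear_combination shearRate s d r * (hsq - hdq + Real.cos s * hrad))
    refine exists_conjugate_dihedral hn H.mul_eq (Or.inl rfl) k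
      (mul_mem_SO2 (Qrot_mem_SO2 (2 * d)) (mul_mem_SO2 (Qrot_mem_SO2 (2 * s * k - d)) hR))
      hB2 rfl hcomm ?_
    rw [oddGrad_eq _ _ hr.ne', hB, Matrix.mul_assoc (Qrot (2 * d)), shear_conj_mul,
      Matrix.mul_assoc, Matrix.mul_assoc, ← h,
      show 2 * s * (k : ℝ) - (2 * s * k - d) = d by ring,
      show 2 * s * (k : ℝ) + (s - d) - (2 * s * k - d) = s by ring, Qrot_sub_smul_Qrot,
      shear_mul]

end IsContiData
lemma isContiData_of_eq {n : ℕ} {s d r : ℝ} (hn : 3 ≤ n) (hns : n * s = π) (hneg : -s < d)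
    (hlt : d < s) (hr : r = 1 / Real.cos s *
      (Real.cos d - √(Real.sin (s - d) * Real.sin (s + d)))) : IsContiData n s d r := by
  have hn3 : (3 : ℝ) ≤ n := by exact_mod_cast hn
  have hs : 0 < s := by linarith
  have hs3 : 3 * s ≤ π := by
    rw [← hns]
    exact mul_le_mul_of_nonneg_right hn3 hs.le
  have hc : 0 < Real.cos s := Real.cos_pos_of_mem_Ioo ⟨by linarith, by linarith⟩
  have hcd : Real.cos s < Real.cos d := by
    rw [← Real.cos_abs d]
    exact Real.cos_lt_cos_of_nonneg_of_le_pi (abs_nonneg d) (by linarith)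
      (abs_lt.2 ⟨hneg, hlt⟩)
  have hprod : Real.sin (s - d) * Real.sin (s + d) = Real.cos d ^ 2 - Real.cos s ^ 2 := by
    rw [Real.sin_sub, Real.sin_add]
    linear_combination Real.cos d ^ 2 * Real.sin_sq_add_cos_sq s -
      Real.cos s ^ 2 * Real.sin_sq_add_cos_sq d
  rw [hprod] at hr
  have hq0 : 0 ≤ √(Real.cos d ^ 2 - Real.cos s ^ 2) := Real.sqrt_nonneg _
  have hq := Real.sq_sqrt (show 0 ≤ Real.cos d ^ 2 - Real.cos s ^ 2 by nlinarith)
  generalize √(Real.cos d ^ 2 - Real.cos s ^ 2) = q at *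
  have hrc : r * Real.cos s = Real.cos d - q := by
    rw [hr]
    field_simp
  refine ⟨hn, hns, hneg, hlt, ?_, ?_, ?_⟩
  · refine pos_of_mul_pos_left (b := Real.cos s) ?_ hc.le
    nlinarith
  · refine lt_of_mul_lt_mul_right (a := Real.cos s) ?_ hc.le
    nlinarith
  · apply mul_left_cancel₀ hc.ne'
    linear_combination (2 * Real.cos d - r * Real.cos s - Real.cos d + q) * hrc - hq

lemma image_Icc_eq_range {V : Type*} {g : ℤ → V} {n : ℕ} (hn : n ≠ 0)
    (hg : ∀ k, g (k % n) = g k) :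
    (fun i => g (i - 1)) '' Set.Icc (1 : ℤ) n = Set.range g := by
  have hn' : (0 : ℤ) < n := by omega
  refine Set.Subset.antisymm ?_ ?_
  · rintro _ ⟨i, -, rfl⟩
    exact ⟨_, rfl⟩
  · rintro _ ⟨k, rfl⟩
    have h0 := Int.emod_nonneg k hn'.ne'
    have h1 := Int.emod_lt_of_pos k hn'
    exact ⟨k % n + 1, ⟨by omega, by omega⟩, by simp only [add_sub_cancel_right, hg]⟩

lemma upperTriangular_conj (a b t : ℝ) (e : Fin 2 → ℝ) :
    a • vecMulVec e e + b • vecMulVec ![-(e 1), e 0] ![-(e 1), e 0] +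
      t • vecMulVec e ![-(e 1), e 0] =
    !![e 0, -(e 1); e 1, e 0] * !![a, t; 0, b] * !![e 0, -(e 1); e 1, e 0]ᵀ := by
  ext i j
  fin_cases i <;> fin_cases j <;>
    simp [Matrix.mul_apply, Fin.sum_univ_two, vecMulVec_apply] <;> ring
end Conti

/-- Proposition 2.4, single-layer Conti construction: under the
necessary conditions on the radius ratio `r_I` and stretch `a`, there exists a locally
Lipschitz map `u : ℝ² → ℝ²` which is affine on each of the `2n` interpolation triangles,
equal to the identity outside the outer regular `n`-gon, equal to the rotation
`R₊ = Q(2π(1−2α)/n)` on the inner regular `n`-gon, and whose gradient a.e. on the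
annular region lies in `⋃_{P ∈ 𝒫_n} SO(2)·P·U·Pᵀ` with `𝒫_n = B·𝒫̂_n·Bᵀ`. -/
theorem single_layer_conti_construction (n : ℕ) (hn : 3 ≤ n) (α : ℝ)
    (hα : α ∈ Set.Ioo (0 : ℝ) 1) (rI a : ℝ)
    (hrI : rI = (1 / Real.cos (π / n)) *
      (Real.cos (π * (1 - 2 * α) / n) -
        Real.sqrt (Real.sin (2 * π * α / n) * Real.sin (2 * π * (1 - α) / n))))
    (ha : a = Real.sqrt (Real.sin (2 * π * (1 - α) / n) / Real.sin (2 * π * α / n)))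
    (E I : ℤ → (Fin 2 → ℝ))
    (hE : ∀ i : ℤ,
      E i = ![Real.cos (2 * π * ((i : ℝ) - 1) / n), Real.sin (2 * π * ((i : ℝ) - 1) / n)])
    (hI : ∀ i : ℤ,
      I i = rI • ![Real.cos (2 * π * ((i : ℝ) - 1) / n + 2 * π * α / n),
                   Real.sin (2 * π * ((i : ℝ) - 1) / n + 2 * π * α / n)])
    (ΩE ΩI : Set (Fin 2 → ℝ))
    (hΩE : ΩE = convexHull ℝ (E '' Set.Icc (1 : ℤ) (n : ℤ)))
    (hΩI : ΩI = convexHull ℝ (I '' Set.Icc (1 : ℤ) (n : ℤ)))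
    (T : ℤ → Set (Fin 2 → ℝ))
    (hTodd : ∀ i : ℤ, Odd i →
      T i = interior (convexHull ℝ {E ((i + 1) / 2), I ((i - 1) / 2), I ((i + 1) / 2)}))
    (hTeven : ∀ i : ℤ, Even i →
      T i = interior (convexHull ℝ {E (i / 2), I (i / 2), E (i / 2 + 1)}))
    (e11 e11p : Fin 2 → ℝ)
    (he11 : e11 =
      (Real.sqrt ((E 1 0 - I 1 0) ^ 2 + (E 1 1 - I 1 1) ^ 2))⁻¹ • (E 1 - I 1))
    (he11p : e11p = ![-(e11 1), e11 0])
    (U B : Matrix (Fin 2) (Fin 2) ℝ)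
    (hU : U = a • vecMulVec e11 e11 + a⁻¹ • vecMulVec e11p e11p +
      ((a⁻¹ - a) * Real.tan (π / n)) • vecMulVec e11 e11p)
    (hB : B = !![e11 0, e11p 0; e11 1, e11p 1]) :
    ∃ u : (Fin 2 → ℝ) → (Fin 2 → ℝ),
      LocallyLipschitz u ∧
      (∀ i : ℤ, 1 ≤ i → i ≤ 2 * (n : ℤ) →
        ∃ (A : Matrix (Fin 2) (Fin 2) ℝ) (b : Fin 2 → ℝ),
          ∀ x ∈ T i, u x = A.mulVec x + b) ∧
      (∀ x : Fin 2 → ℝ, x ∉ ΩE → u x = x) ∧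
      (∀ x ∈ ΩI, u x = (Qrot (2 * π * (1 - 2 * α) / n)).mulVec x) ∧
      (∀ᵐ x ∂(volume.restrict (ΩE \ ΩI)),
        ∃ P ∈ (fun P => B * P * Bᵀ) '' dihedral n, ∃ R ∈ SO2,
          HasFDerivAt u (Matrix.mulVecLin (R * (P * U * Pᵀ))).toContinuousLinearMap x) := by
  have hn0 : n ≠ 0 := by omega
  have hnR : (n : ℝ) ≠ 0 := by exact_mod_cast hn0
  have hπn : 0 < π / n := by positivity
  obtain ⟨s, hs⟩ : ∃ s, s = π / n := ⟨_, rfl⟩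
  obtain ⟨d, hd⟩ : ∃ d, d = π * (1 - 2 * α) / n := ⟨_, rfl⟩
  have hds : d = s * (1 - 2 * α) := by rw [hd, hs]; ring
  have e1 : 2 * π * α / n = s - d := by rw [hds, hs]; ring
  have e2 : 2 * π * (1 - α) / n = s + d := by rw [hds, hs]; ring
  have e3 : 2 * π * (1 - 2 * α) / n = 2 * d := by rw [hds, hs]; ring
  have e4 (i : ℤ) : 2 * π * ((i : ℝ) - 1) / n = 2 * s * ((i - 1 : ℤ) : ℝ) := by
    rw [hs]; push_cast; ring
  rw [← hs] at hπn hrI hU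
  rw [← hd, e1, e2] at hrI
  rw [e1, e2] at ha
  rw [e3]
  have H : Conti.IsContiData n s d rI :=
    Conti.isContiData_of_eq hn (by rw [hs]; field_simp) (by rw [hds]; nlinarith [hα.2])
      (by rw [hds]; nlinarith [hα.1]) hrI
  obtain rfl : E = fun i => Conti.outer s (i - 1) := by
    funext i
    rw [hE, e4]
    rfl
  obtain rfl : I = fun i => Conti.inner s d rI (i - 1) := by
    funext i
    rw [hI, e4, e1]
    rfl
  rw [Conti.image_Icc_eq_range hn0 H.outer_emod] at hΩE
  rw [Conti.image_Icc_eq_range hn0 H.inner_emod] at hΩI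
  subst hΩE hΩI
  obtain ⟨K, hK⟩ := H.exists_lipschitzWith_contiMap
  refine ⟨Conti.contiMap s d rI, hK.locallyLipschitz, fun i _ _ => ?_,
    fun x hx => H.contiMap_of_notMem_outer hx, fun x hx => H.contiMap_of_mem_inner hx, ?_⟩
  · rcases Int.even_or_odd i with hi | hi
    · refine ⟨_, _, fun x hx => H.contiMap_of_mem_even_triangle (k := i / 2 - 1) ?_⟩
      rw [hTeven i hi] at hx
      have := interior_subset hx
      simpa only [add_sub_cancel_right, sub_add_cancel] using this
    · refine ⟨_, _, fun x hx => H.contiMap_of_mem_odd_triangle (k := (i + 1) / 2 - 1) ?_⟩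
      rw [hTodd i hi, show (i - 1) / 2 = (i + 1) / 2 - 1 by omega] at hx
      exact interior_subset hx
  · filter_upwards [H.ae_hasFDerivAt_contiMap] with x hx
    obtain ⟨k, M, hM, hMx⟩ := hx
    have hB' : B = (√(1 + rI ^ 2 - 2 * rI * Real.cos (s - d)))⁻¹ •
        (1 - rI • Qrot (s - d)) := by
      have hE1 : Conti.outer s (1 - 1) = ![1, 0] := by simp [Conti.outer, Conti.dir]
      have hI1 : Conti.inner s d rI (1 - 1) =
          ![rI * Real.cos (s - d), rI * Real.sin (s - d)] := by
        simp [Conti.inner, Conti.dir]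
      have hsq : (1 - rI * Real.cos (s - d)) ^ 2 + (0 - rI * Real.sin (s - d)) ^ 2 =
          1 + rI ^ 2 - 2 * rI * Real.cos (s - d) := by
        linear_combination rI ^ 2 * Real.sin_sq_add_cos_sq (s - d)
      simp only [hE1, hI1, Matrix.cons_val_zero, Matrix.cons_val_one, hsq] at he11
      rw [hB, he11p, he11]
      ext i j
      fin_cases i <;> fin_cases j <;> simp [Qrot]
    have hU' : U = B * !![a, (a⁻¹ - a) * Real.tan s; 0, a⁻¹] * Bᵀ := by
      rw [hU, hB, he11p]
      exact Conti.upperTriangular_conj a a⁻¹ _ e11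
    obtain ⟨P, hP, R, hR, rfl⟩ := H.exists_grad_eq ha hB' hM
    rw [← hU'] at hMx
    exact ⟨P, hP, R, hR, hMx⟩
end
end

section
/- Let n ≥ 3 be an integer, α ∈ (0,1), a = sqrt( sin(2π(1−α)/n) / sin(2πα/n) ), and let U₁ be the 2×2 matrix with rows (a, (a⁻¹ − a)·tan(π/n)) and (0, a⁻¹), and D = diag(1,−1). Then D·U₁·D·Q(2π(1−α)/n) = Q(2πα/n)·U₁, where Q(θ) denotes the rotation matrix ((cos θ, −sin θ),(sin θ, cos θ)). -/
open Real Matrix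

noncomputable section

theorem cos_sub_cos_eq_tan_mul {x y : ℝ} (h : Real.cos ((x + y) / 2) ≠ 0) :
    Real.cos x - Real.cos y = Real.tan ((x + y) / 2) * (Real.sin y - Real.sin x) := by
  rw [Real.cos_sub_cos, Real.sin_sub_sin, Real.tan_eq_sin_div_cos, add_comm y x,
    ← neg_sub x y, neg_div, Real.sin_neg]
  field_simp

theorem sin_add_sin_eq_tan_mul {x y : ℝ} (h : Real.cos ((x + y) / 2) ≠ 0) :
    Real.sin x + Real.sin y = Real.tan ((x + y) / 2) * (Real.cos x + Real.cos y) := by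
  rw [Real.cos_add_cos, Real.tan_eq_sin_div_cos, ← sub_neg_eq_add (Real.sin x), ← Real.sin_neg,
    Real.sin_sub_sin, sub_neg_eq_add, ← sub_eq_add_neg]
  field_simp

/-- The reflected stretched shear composed with the rotation by `x` is the original one followed by
the rotation by `y`. -/
theorem reflect_mul_Qrot_eq_Qrot_mul {x y a : ℝ} (ha : a ≠ 0)
    (hc : Real.cos ((x + y) / 2) ≠ 0) (hxy : a ^ 2 * Real.sin y = Real.sin x) :
    !![(1 : ℝ), 0; 0, -1] * !![a, (a⁻¹ - a) * Real.tan ((x + y) / 2); 0, a⁻¹] *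
      !![(1 : ℝ), 0; 0, -1] * Qrot x =
    Qrot y * !![a, (a⁻¹ - a) * Real.tan ((x + y) / 2); 0, a⁻¹] := by
  have h₁ := cos_sub_cos_eq_tan_mul hc
  have h₂ := sin_add_sin_eq_tan_mul hc
  generalize Real.tan ((x + y) / 2) = t at *
  have h₃ : Real.sin y - a ^ 2 * Real.sin x = (1 - a ^ 2) * t * (Real.cos x + Real.cos y) := by
    rw [← hxy] at h₂ ⊢
    linear_combination (1 - a ^ 2) * h₂
  ext i j
  fin_cases i <;> fin_cases j <;>
    simp [Qrot, Matrix.mul_apply, Fin.sum_univ_two] <;> field_simp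
  · linear_combination a ^ 2 * h₁ + t * hxy
  · linear_combination h₃
  · linear_combination -hxy
  · linear_combination h₁ + t * hxy

/-- For `n ≥ 3`, `α ∈ (0,1)`, `a = sqrt(sin(2π(1−α)/n)/sin(2πα/n))`,
`U₁ = ((a, (a⁻¹−a)·tan(π/n)), (0, a⁻¹))` and `D = diag(1,−1)`, one has
`D·U₁·D·Q(2π(1−α)/n) = Q(2πα/n)·U₁`. -/
theorem iterability_identity (n : ℕ) (hn : 3 ≤ n) (α : ℝ) (hα : α ∈ Set.Ioo (0 : ℝ) 1)
    (a : ℝ)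
    (ha : a = Real.sqrt (Real.sin (2 * π * (1 - α) / n) / Real.sin (2 * π * α / n)))
    (U₁ D : Matrix (Fin 2) (Fin 2) ℝ)
    (hU₁ : U₁ = !![a, (a⁻¹ - a) * Real.tan (π / n); 0, a⁻¹])
    (hD : D = !![(1 : ℝ), 0; 0, -1]) :
    D * U₁ * D * Qrot (2 * π * (1 - α) / n) = Qrot (2 * π * α / n) * U₁ := by
  obtain ⟨h₀, h₁⟩ := hα
  have hn' : (3 : ℝ) ≤ n := by exact_mod_cast hn
  have hn₀ : (0 : ℝ) < n := by linarith
  have hsin : ∀ β : ℝ, 0 < β → β < 1 → 0 < Real.sin (2 * π * β / n) := by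
    intro β hβ₀ hβ₁
    apply Real.sin_pos_of_pos_of_lt_pi (by positivity)
    rw [div_lt_iff₀ hn₀]
    nlinarith [Real.pi_pos]
  have hx := hsin (1 - α) (by linarith) (by linarith)
  have hy := hsin α h₀ h₁
  have hsum : (2 * π * (1 - α) / n + 2 * π * α / n) / 2 = π / n := by ring
  have hcos : Real.cos ((2 * π * (1 - α) / n + 2 * π * α / n) / 2) ≠ 0 := by
    rw [hsum]
    refine (Real.cos_pos_of_mem_Ioo ⟨?_, ?_⟩).ne'
    · have : 0 < π / n := by positivity
      linarith [Real.pi_pos]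
    · exact div_lt_div_of_pos_left Real.pi_pos two_pos (by linarith)
  have ha₀ : a ≠ 0 := by
    rw [ha]
    positivity
  have hxy : a ^ 2 * Real.sin (2 * π * α / n) = Real.sin (2 * π * (1 - α) / n) := by
    rw [ha, Real.sq_sqrt (by positivity), div_mul_cancel₀ _ hy.ne']
  rw [hU₁, hD, ← hsum]
  exact reflect_mul_Qrot_eq_Qrot_mul ha₀ hcos hxy
end
end

section
/- Let n ≥ 3 be an odd integer, a > 0, and let U₁ be the 2×2 matrix with rows (a, (a⁻¹ − a)·tan(π/n)) and (0, a⁻¹), and D = diag(1,−1). Then Q(π(n−1)/n)·(D·U₁·D)·Q(π(n−1)/n)ᵀ = U₁ᵀ, where Q(θ) denotes the rotation matrix ((cos θ, −sin θ),(sin θ, cos θ)). -/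
open Real Matrix

noncomputable section

/-- Conjugating the reflected shear-stretch matrix by the rotation of angle `π - φ` transposes the
original one, provided the off-diagonal entry is `(p - a) * tan φ`. -/
theorem Qrot_pi_sub_conj (a p φ : ℝ) (hφ : Real.cos φ ≠ 0) :
    Qrot (π - φ) * !![a, -((p - a) * Real.tan φ); 0, p] * (Qrot (π - φ))ᵀ =
      !![a, (p - a) * Real.tan φ; 0, p]ᵀ := by
  obtain ⟨t, ht⟩ : ∃ t, t = Real.tan φ := ⟨_, rfl⟩
  have hs : Real.sin φ = t * Real.cos φ := by rw [ht, Real.tan_mul_cos hφ]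
  have hc : (1 + t ^ 2) * Real.cos φ ^ 2 = 1 := by
    linear_combination Real.sin_sq_add_cos_sq φ - (Real.sin φ + t * Real.cos φ) * hs
  rw [← ht]
  ext i j
  fin_cases i <;> fin_cases j <;>
    simp [Qrot, Matrix.mul_apply, Fin.sum_univ_two, Real.cos_pi_sub, Real.sin_pi_sub, hs]
  · linear_combination a * hc
  · ring
  · linear_combination (p - a) * t * hc
  · linear_combination p * hc

/-- For odd `n ≥ 3`, `a > 0`,
`U₁ = ((a, (a⁻¹−a)·tan(π/n)), (0, a⁻¹))` and `D = diag(1,−1)`, one has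
`Q(π(n−1)/n)·(D·U₁·D)·Q(π(n−1)/n)ᵀ = U₁ᵀ`. -/
theorem opposite_triangle_transpose (n : ℕ) (hn : 3 ≤ n) (hodd : Odd n) (a : ℝ)
    (ha : 0 < a) (U₁ D : Matrix (Fin 2) (Fin 2) ℝ)
    (hU₁ : U₁ = !![a, (a⁻¹ - a) * Real.tan (π / n); 0, a⁻¹])
    (hD : D = !![(1 : ℝ), 0; 0, -1]) :
    Qrot (π * ((n : ℝ) - 1) / n) * (D * U₁ * D) * (Qrot (π * ((n : ℝ) - 1) / n))ᵀ = U₁ᵀ := by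
  have hn' : (3 : ℝ) ≤ n := by exact_mod_cast hn
  have hn0 : (0 : ℝ) < n := by linarith
  have hcos : Real.cos (π / n) ≠ 0 := by
    refine (Real.cos_pos_of_mem_Ioo ⟨?_, ?_⟩).ne'
    · linarith [Real.pi_pos, div_pos Real.pi_pos hn0]
    · exact div_lt_div_of_pos_left Real.pi_pos two_pos (by linarith)
  have hang : π * ((n : ℝ) - 1) / n = π - π / n := by field_simp
  have hDUD : D * U₁ * D = !![a, -((a⁻¹ - a) * Real.tan (π / n)); 0, a⁻¹] := by
    simp [hU₁, hD]
  rw [hDUD, hang, hU₁, Qrot_pi_sub_conj _ _ _ hcos]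
end
end

section
/- Let n ≥ 3 be an integer, α ∈ (0,1), a = sqrt( sin(2π(1−α)/n) / sin(2πα/n) ), U₁ the 2×2 matrix with rows (a, (a⁻¹ − a)·tan(π/n)) and (0, a⁻¹), C = U₁ᵀ·U₁, D = diag(1,−1), and let 𝒫̂_n = {Q(2πj/n) : 0 ≤ j ≤ n−1} ∪ {D·Q(2πj/n) : 0 ≤ j ≤ n−1}. Then Q(2πα/n)·D·C·D·Q(2πα/n)ᵀ ∈ {Pᵀ·C·P : P ∈ 𝒫̂_n}. -/
open Real Matrix

noncomputable section

/-- Conjugating the reflected symmetric matrix by a rotation with cosine `c` and sine `s` agrees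
with conjugating the matrix itself by a rotation with cosine `p` and sine `q`, as soon as the
off-diagonal part vanishes in the eigenframe determined by the two angles. -/
lemma reflected_conj_eq_conj {A B E c s p q : ℝ} (hcs : s ^ 2 + c ^ 2 = 1)
    (hpq : q ^ 2 + p ^ 2 = 1)
    (h : 2 * B * (p * c + q * s) + (A - E) * (q * c - p * s) = 0) :
    !![c, -s; s, c] * !![(1 : ℝ), 0; 0, -1] * !![A, B; B, E] * !![(1 : ℝ), 0; 0, -1] *
        !![c, -s; s, c]ᵀ =
      !![p, q; -q, p]ᵀ * !![A, B; B, E] * !![p, q; -q, p] := by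
  ext i j
  fin_cases i <;> fin_cases j <;> simp [Matrix.mul_apply, Fin.sum_univ_two]
  · linear_combination (q * c + p * s) * h + (A * p ^ 2 - 2 * B * p * q + E * q ^ 2) * hcs -
      (A * c ^ 2 + 2 * B * c * s + E * s ^ 2) * hpq
  · linear_combination (q * s - p * c) * h + ((A - E) * p * q + B * (p ^ 2 - q ^ 2)) * hcs -
      ((A - E) * c * s - B * (c ^ 2 - s ^ 2)) * hpq
  · linear_combination (q * s - p * c) * h + ((A - E) * p * q + B * (p ^ 2 - q ^ 2)) * hcs -
      ((A - E) * c * s - B * (c ^ 2 - s ^ 2)) * hpq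
  · linear_combination -(q * c + p * s) * h + (A * q ^ 2 + 2 * B * p * q + E * p ^ 2) * hcs -
      (A * s ^ 2 - 2 * B * c * s + E * c ^ 2) * hpq

/-- The eigenframe relation satisfied by the entries of `U₁ᵀ * U₁`, where `x = a ^ 2`. -/
lemma eigenframe_relation {x t β θ : ℝ} (hx : x ≠ 0) (hcos : cos β ≠ 0)
    (ht : t = tan β) (hxs : x * sin θ = sin (2 * β - θ)) :
    2 * ((1 - x) * t) * (cos (2 * β) * cos θ + sin (2 * β) * sin θ) +
      (x - ((x⁻¹ - 2 + x) * t ^ 2 + x⁻¹)) *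
        (sin (2 * β) * cos θ - cos (2 * β) * sin θ) = 0 := by
  have htc : t * cos β = sin β := by rw [ht, tan_mul_cos hcos]
  have hp : cos (2 * β) = cos β ^ 2 * (1 - t ^ 2) := by
    rw [cos_two_mul', ← htc]; ring
  have hq : sin (2 * β) = 2 * t * cos β ^ 2 := by
    rw [sin_two_mul, ← htc]; ring
  have hone : cos β ^ 2 * (1 + t ^ 2) = 1 := by
    have hβ := sin_sq_add_cos_sq β
    rw [← htc] at hβ
    linear_combination hβ
  rw [sin_sub] at hxs
  have hpq := sin_sq_add_cos_sq (2 * β)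
  have key : 2 * t * (cos (2 * β) * cos θ + sin (2 * β) * sin θ) -
      ((x + 1) - (x - 1) * t ^ 2) * sin θ = 0 := by
    apply mul_left_cancel₀ (pow_ne_zero 2 hcos)
    linear_combination (-(cos (2 * β) * cos θ + sin (2 * β) * sin θ)) * hq +
      x * sin θ * hp - sin θ * hone - cos (2 * β) * hxs + sin θ * hpq
  rw [← hxs]
  have hfac : x - ((x⁻¹ - 2 + x) * t ^ 2 + x⁻¹) =
      x⁻¹ * ((x - 1) * ((x + 1) - (x - 1) * t ^ 2)) := by
    field_simp; ring
  rw [hfac]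
  have : x⁻¹ * x = 1 := inv_mul_cancel₀ hx
  linear_combination (1 - x) * key +
    (x - 1) * ((x + 1) - (x - 1) * t ^ 2) * sin θ * this

/-- For `n ≥ 3`, `α ∈ (0,1)`, `a = sqrt(sin(2π(1−α)/n)/sin(2πα/n))`,
`U₁ = ((a, (a⁻¹−a)·tan(π/n)), (0, a⁻¹))`, `C = U₁ᵀ·U₁` and `D = diag(1,−1)`, the matrix
`Q(2πα/n)·D·C·D·Q(2πα/n)ᵀ` belongs to the dihedral orbit `{Pᵀ·C·P : P ∈ 𝒫̂_n}`. -/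
theorem outer_triangle_iterability (n : ℕ) (hn : 3 ≤ n) (α : ℝ)
    (hα : α ∈ Set.Ioo (0 : ℝ) 1) (a : ℝ)
    (ha : a = Real.sqrt (Real.sin (2 * π * (1 - α) / n) / Real.sin (2 * π * α / n)))
    (U₁ C D : Matrix (Fin 2) (Fin 2) ℝ)
    (hU₁ : U₁ = !![a, (a⁻¹ - a) * Real.tan (π / n); 0, a⁻¹]) (hC : C = U₁ᵀ * U₁)
    (hD : D = !![(1 : ℝ), 0; 0, -1]) :
    Qrot (2 * π * α / n) * D * C * D * (Qrot (2 * π * α / n))ᵀ ∈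
      {M : Matrix (Fin 2) (Fin 2) ℝ | ∃ P ∈ dihedral n, M = Pᵀ * C * P} := by
  obtain ⟨hα0, hα1⟩ := hα
  have hn' : (3 : ℝ) ≤ n := by exact_mod_cast hn
  have hn0 : (0 : ℝ) < n := by linarith
  obtain ⟨β, hβ⟩ : ∃ β, β = π / n := ⟨_, rfl⟩
  obtain ⟨θ, hθ⟩ : ∃ θ, θ = 2 * π * α / n := ⟨_, rfl⟩
  have hθβ : θ = 2 * β * α := by rw [hθ, hβ]; ring
  have hdiff : 2 * π * (1 - α) / n = 2 * β - θ := by rw [hθ, hβ]; ring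
  have hβ0 : 0 < β := by rw [hβ]; positivity
  have hβ3 : β ≤ π / 3 := by
    rw [hβ]; exact div_le_div_of_nonneg_left pi_pos.le (by norm_num) hn'
  have hθ0 : 0 < θ := by rw [hθβ]; positivity
  have hθ1 : θ < 2 * β := by rw [hθβ]; nlinarith
  have hπ := pi_pos
  have hsin : 0 < sin θ := sin_pos_of_pos_of_lt_pi hθ0 (by linarith)
  have hsin' : 0 < sin (2 * β - θ) := sin_pos_of_pos_of_lt_pi (by linarith) (by linarith)
  have hcos : cos β ≠ 0 := (cos_pos_of_mem_Ioo ⟨by linarith, by linarith⟩).ne'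
  rw [hdiff, ← hθ] at ha
  have ha0 : a ≠ 0 := by rw [ha]; exact (sqrt_pos.2 (div_pos hsin' hsin)).ne'
  have hasq : a ^ 2 = sin (2 * β - θ) / sin θ := by
    rw [ha, sq_sqrt (div_pos hsin' hsin).le]
  have hxs : a ^ 2 * sin θ = sin (2 * β - θ) := by
    rw [hasq, div_mul_cancel₀ _ hsin.ne']
  have hC' : C = !![a ^ 2, (1 - a ^ 2) * tan β; (1 - a ^ 2) * tan β,
      ((a ^ 2)⁻¹ - 2 + a ^ 2) * tan β ^ 2 + (a ^ 2)⁻¹] := by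
    rw [hC, hU₁, ← hβ]
    ext i j
    fin_cases i <;> fin_cases j <;> simp [Matrix.mul_apply, Fin.sum_univ_two] <;>
      field_simp <;> ring
  refine ⟨Qrot (2 * π * (n - 1 : ℕ) / n), Or.inl ⟨n - 1, by omega, rfl⟩, ?_⟩
  have hangle : 2 * π * ((n - 1 : ℕ) : ℝ) / n = 2 * π - 2 * β := by
    rw [Nat.cast_sub (by omega), hβ]; field_simp; simp
  have hQ : Qrot (2 * π * (n - 1 : ℕ) / n) =
      !![cos (2 * β), sin (2 * β); -sin (2 * β), cos (2 * β)] := by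
    rw [hangle, Qrot, cos_two_pi_sub, sin_two_pi_sub, neg_neg]
  rw [hQ, hC', hD, ← hθ, Qrot]
  exact reflected_conj_eq_conj (sin_sq_add_cos_sq θ) (sin_sq_add_cos_sq (2 * β))
    (eigenframe_relation (pow_ne_zero 2 ha0) hcos rfl hxs)
end
end

section
/- Let n ≥ 3 be an integer, α ∈ (0,1), a = sqrt( sin(2π(1−α)/n) / sin(2πα/n) ), U₁ the 2×2 matrix with rows (a, (a⁻¹ − a)·tan(π/n)) and (0, a⁻¹), and C = U₁ᵀ·U₁. Then the vector v = (cos(π(α−1)/n), sin(π(α−1)/n)) is an eigenvector of C; equivalently, vᵀ·J·C·v = 0 where J = ((0,−1),(1,0)). -/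
open Real Matrix

noncomputable section

/-- A double-angle identity for the tangent of a sum, with the sines of the double angles halved. -/
theorem tan_add_double_angle_identity (θ ψ : ℝ) (h : cos (θ + ψ) ≠ 0) :
    -tan (θ + ψ) * (cos θ ^ 2 - sin θ ^ 2) +
      (sin ψ * cos ψ - sin θ * cos θ) * tan (θ + ψ) ^ 2 +
      (sin ψ * cos ψ + sin θ * cos θ) = 0 := by
  have hθ := sin_sq_add_cos_sq θ
  have hψ := sin_sq_add_cos_sq ψ
  have hsub : sin ψ * cos ψ - sin θ * cos θ =
      cos (θ + ψ) * (sin ψ * cos θ - cos ψ * sin θ) := by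
    rw [cos_add]
    linear_combination -(sin ψ * cos ψ) * hθ + sin θ * cos θ * hψ
  have hadd : sin ψ * cos ψ + sin θ * cos θ =
      sin (θ + ψ) * (cos θ * cos ψ + sin θ * sin ψ) := by
    rw [sin_add]
    linear_combination -(sin ψ * cos ψ) * hθ - sin θ * cos θ * hψ
  have hsum : (sin ψ * cos θ - cos ψ * sin θ) * sin (θ + ψ) +
      (cos θ * cos ψ + sin θ * sin ψ) * cos (θ + ψ) = cos θ ^ 2 - sin θ ^ 2 := by
    rw [sin_add, cos_add]
    linear_combination (cos θ ^ 2 - sin θ ^ 2) * hψ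
  rw [hsub, hadd, tan_eq_sin_div_cos]
  field_simp
  linear_combination sin (θ + ψ) * hsum

/-- A unit vector `v` in the plane with `v ⬝ᵥ J w = 0` is parallel to `w`. -/
theorem eq_dotProduct_smul_of_cross_eq_zero {v w : Fin 2 → ℝ} (hv : v 0 ^ 2 + v 1 ^ 2 = 1)
    (h : v ⬝ᵥ !![(0 : ℝ), -1; 1, 0].mulVec w = 0) : w = (v ⬝ᵥ w) • v := by
  simp only [dotProduct, mulVec, Fin.sum_univ_two, of_apply, cons_val_zero, cons_val_one,
    cons_val', cons_val_fin_one] at h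
  ext i
  fin_cases i
  · simp [dotProduct, Fin.sum_univ_two]
    linear_combination -w 0 * hv + v 1 * h
  · simp [dotProduct, Fin.sum_univ_two]
    linear_combination -w 1 * hv - v 0 * h

/-- For `n ≥ 3`, `α ∈ (0,1)`, `a = sqrt(sin(2π(1−α)/n)/sin(2πα/n))`,
`U₁ = ((a, (a⁻¹−a)·tan(π/n)), (0, a⁻¹))` and `C = U₁ᵀ·U₁`, the vector
`v = (cos(π(α−1)/n), sin(π(α−1)/n))` is an eigenvector of `C`; equivalently,
`vᵀ·J·C·v = 0` with `J = ((0,−1),(1,0))`. -/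
theorem eigenvector_of_cauchy_green (n : ℕ) (hn : 3 ≤ n) (α : ℝ)
    (hα : α ∈ Set.Ioo (0 : ℝ) 1) (a : ℝ)
    (ha : a = Real.sqrt (Real.sin (2 * π * (1 - α) / n) / Real.sin (2 * π * α / n)))
    (U₁ C J : Matrix (Fin 2) (Fin 2) ℝ)
    (hU₁ : U₁ = !![a, (a⁻¹ - a) * Real.tan (π / n); 0, a⁻¹]) (hC : C = U₁ᵀ * U₁)
    (hJ : J = !![(0 : ℝ), -1; 1, 0]) (v : Fin 2 → ℝ)
    (hv : v = ![Real.cos (π * (α - 1) / n), Real.sin (π * (α - 1) / n)]) :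
    (∃ μ : ℝ, C.mulVec v = μ • v) ∧ v ⬝ᵥ (J * C).mulVec v = 0 := by
  obtain ⟨hα0, hα1⟩ := hα
  have hn' : (3 : ℝ) ≤ n := by exact_mod_cast hn
  have hn0 : (0 : ℝ) < n := by linarith
  set θ := π * (1 - α) / n with hθ
  set ψ := π * α / n with hψ
  have hsum : π / n = θ + ψ := by rw [hθ, hψ]; ring
  have hθ0 : 0 < θ := div_pos (mul_pos pi_pos (by linarith)) hn0
  have hψ0 : 0 < ψ := div_pos (mul_pos pi_pos hα0) hn0
  have hlt : θ + ψ < π / 2 := by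
    rw [← hsum]
    exact div_lt_div_of_pos_left pi_pos two_pos (by linarith)
  have hcos : cos (θ + ψ) ≠ 0 := (cos_pos_of_mem_Ioo ⟨by linarith, hlt⟩).ne'
  have hθ2 : 0 < sin (2 * θ) := sin_pos_of_pos_of_lt_pi (by linarith) (by linarith)
  have hψ2 : 0 < sin (2 * ψ) := sin_pos_of_pos_of_lt_pi (by linarith) (by linarith)
  rw [show 2 * π * (1 - α) / n = 2 * θ by rw [hθ]; ring,
    show 2 * π * α / n = 2 * ψ by rw [hψ]; ring] at ha
  have ha0 : a ≠ 0 := by rw [ha]; exact (sqrt_pos.2 (div_pos hθ2 hψ2)).ne'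
  have hsq : a ^ 2 * (sin ψ * cos ψ) = sin θ * cos θ := by
    have : a ^ 2 * sin (2 * ψ) = sin (2 * θ) := by
      rw [ha, sq_sqrt (div_pos hθ2 hψ2).le, div_mul_cancel₀ _ hψ2.ne']
    rw [sin_two_mul, sin_two_mul] at this
    linarith
  have hψne : sin ψ * cos ψ ≠ 0 := by
    rw [sin_two_mul] at hψ2
    intro h
    linarith
  rw [show π * (α - 1) / n = -θ by rw [hθ]; ring, cos_neg, sin_neg] at hv
  rw [hsum] at hU₁
  have key : -a ^ 2 * tan (θ + ψ) * (cos θ ^ 2 - sin θ ^ 2) +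
      ((1 - a ^ 2) * tan (θ + ψ) ^ 2 + 1 + a ^ 2) * (sin θ * cos θ) = 0 := by
    refine (mul_eq_zero.1 ?_).resolve_left hψne
    linear_combination (sin θ * cos θ) * tan_add_double_angle_identity θ ψ hcos +
      (-tan (θ + ψ) * (cos θ ^ 2 - sin θ ^ 2) +
        (1 - tan (θ + ψ) ^ 2) * (sin θ * cos θ)) * hsq
  have hcross : v ⬝ᵥ (J * C).mulVec v = 0 := by
    subst hv hJ hC hU₁
    simp [dotProduct, mulVec, Fin.sum_univ_two, Matrix.mul_apply]
    field_simp
    linear_combination (1 - a ^ 2) * key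
  refine ⟨⟨v ⬝ᵥ C.mulVec v, eq_dotProduct_smul_of_cross_eq_zero ?_ ?_⟩, hcross⟩
  · simp [hv]
  · rwa [mulVec_mulVec, ← hJ]
end
end

section
/- Fix α ∈ (0,1) and for each integer n ≥ 3 let r_I(n) = (1/cos(π/n))·(cos(π(1−2α)/n) − sqrt( sin(2πα/n) · sin(2π(1−α)/n) )). Then n·(1 − r_I(n)) → 2π·sqrt(α(1−α)) as n → ∞. -/
open Real Filter

lemma HasDerivAt.tendsto_nat_mul_sub {f : ℝ → ℝ} {f' : ℝ} (hf : HasDerivAt f f' 0) (c : ℝ) :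
    Tendsto (fun n : ℕ => (n : ℝ) * (f (c / n) - f 0)) atTop (nhds (f' * c)) := by
  have hg : HasDerivAt (fun t : ℝ => f (c * t)) (f' * c) 0 := by
    have hf' : HasDerivAt f f' (c * 0) := by simpa using hf
    simpa [Function.comp_def] using hf'.comp (0 : ℝ) ((hasDerivAt_id (0 : ℝ)).const_mul c)
  have hinv : Tendsto (fun n : ℕ => ((n : ℝ))⁻¹) atTop (nhdsWithin 0 {0}ᶜ) := by
    refine tendsto_nhdsWithin_iff.2 ⟨tendsto_inv_atTop_nhds_zero_nat, ?_⟩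
    filter_upwards [eventually_gt_atTop 0] with n hn
    simp [hn.ne']
  refine (hg.tendsto_slope_zero.comp hinv).congr fun n => ?_
  simp [div_eq_mul_inv]

lemma tendsto_nat_mul_cos_div_sub_one (c : ℝ) :
    Tendsto (fun n : ℕ => (n : ℝ) * (Real.cos (c / n) - 1)) atTop (nhds 0) := by
  simpa using (Real.hasDerivAt_cos 0).tendsto_nat_mul_sub c

lemma tendsto_nat_mul_sin_div (c : ℝ) :
    Tendsto (fun n : ℕ => (n : ℝ) * Real.sin (c / n)) atTop (nhds c) := by
  simpa using (Real.hasDerivAt_sin 0).tendsto_nat_mul_sub c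

/-- Fix `α ∈ (0,1)` and for each integer `n ≥ 3` let
`r_I(n) = (1/cos(π/n))·(cos(π(1−2α)/n) − sqrt(sin(2πα/n)·sin(2π(1−α)/n)))`. Then
`n·(1 − r_I(n)) → 2π·sqrt(α(1−α))` as `n → ∞`. -/
theorem radius_ratio_asymptotics (α : ℝ) (hα : α ∈ Set.Ioo (0 : ℝ) 1)
    (rI : ℕ → ℝ)
    (hrI : ∀ n : ℕ, 3 ≤ n → rI n = (1 / Real.cos (π / n)) *
      (Real.cos (π * (1 - 2 * α) / n) -
        Real.sqrt (Real.sin (2 * π * α / n) * Real.sin (2 * π * (1 - α) / n)))) :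
    Tendsto (fun n : ℕ => (n : ℝ) * (1 - rI n)) atTop
      (nhds (2 * π * Real.sqrt (α * (1 - α)))) := by
  have hcos : Tendsto (fun n : ℕ => Real.cos (π / n)) atTop (nhds 1) := by
    simpa [Function.comp_def] using (Real.continuous_cos.tendsto 0).comp
      (tendsto_const_div_atTop_nhds_zero_nat π)
  have hlim := (((tendsto_nat_mul_cos_div_sub_one π).sub
    (tendsto_nat_mul_cos_div_sub_one (π * (1 - 2 * α)))).add
    ((tendsto_nat_mul_sin_div (2 * π * α)).mul
      (tendsto_nat_mul_sin_div (2 * π * (1 - α)))).sqrt).div hcos one_ne_zero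
  have hval : Real.sqrt (2 * π * α * (2 * π * (1 - α))) = 2 * π * Real.sqrt (α * (1 - α)) := by
    rw [show 2 * π * α * (2 * π * (1 - α)) = (2 * π) ^ 2 * (α * (1 - α)) by ring,
      Real.sqrt_mul (sq_nonneg _), Real.sqrt_sq (by positivity)]
  rw [hval, sub_self, zero_add, div_one] at hlim
  refine hlim.congr' ?_
  filter_upwards [eventually_ge_atTop 3, hcos.eventually_ne one_ne_zero] with n hn hne
  have hsqrt : ∀ x y : ℝ, Real.sqrt ((n : ℝ) * x * (n * y)) = n * Real.sqrt (x * y) := by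
    intro x y
    rw [show (n : ℝ) * x * (n * y) = (n : ℝ) ^ 2 * (x * y) by ring,
      Real.sqrt_mul (sq_nonneg _), Real.sqrt_sq n.cast_nonneg]
  rw [hrI n hn, Pi.div_apply, hsqrt]
  field_simp
  ring
end

section
/- Let α ∈ (0,1), set ρ₀ = (2α−1)/sqrt(α(1−α)), a = sqrt((1−α)/α), and ē = (sqrt(1−α), −sqrt(α)) with ē^⊥ its counterclockwise rotation by π/2. Define v : ℝ² ∖ {0} → ℝ² in polar coordinates x = (r cos ω, r sin ω), r > 0, by v(x) = r·Q(ω + ρ₀·log r)·(2·sqrt(α(1−α)), 1−2α)ᵀ, where Q(θ) is the rotation matrix ((cos θ, −sin θ),(sin θ, cos θ)). Then v is differentiable on the annulus {x : 1/2 < |x| < 1} with total derivative ∇v(x) = Q(ρ₀·log r)·Q(ω)·( a·ē⊗ē + a⁻¹·ē^⊥⊗ē^⊥ )·Q(ω)ᵀ; in particular det(∇v(x)) = 1 and the singular values of ∇v(x) are a and a⁻¹ at every point of the annulus. -/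
open Real Matrix

noncomputable section

/-- Every nonzero vector of the plane has polar coordinates. -/
lemma exists_polar_coordinates (x : Fin 2 → ℝ) (hx : x ≠ 0) :
    ∃ r ω : ℝ, 0 < r ∧ x = ![r * Real.cos ω, r * Real.sin ω] := by
  refine ⟨‖(⟨x 0, x 1⟩ : ℂ)‖, Complex.arg ⟨x 0, x 1⟩, norm_pos_iff.2 fun h => hx ?_, ?_⟩
  · have h0 := congrArg Complex.re h
    have h1 := congrArg Complex.im h
    ext i
    fin_cases i
    · exact h0
    · exact h1
  · ext i
    fin_cases i <;> simp

lemma Qrot_transpose (θ : ℝ) :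
    (Qrot θ)ᵀ = !![Real.cos θ, Real.sin θ; -Real.sin θ, Real.cos θ] := by
  ext i j
  fin_cases i <;> fin_cases j <;> rfl

/-- The derivative of the spiral map `x ↦ |x| Q(ω + ρ log |x|) w`, written in Cartesian
coordinates. In the frame rotated by `ω`, its columns are `w + ρ w^⊥` and `w^⊥`. -/
lemma hasFDerivAt_spiral (ρ w₀ w₁ r ω : ℝ) (hr : 0 < r) :
    HasFDerivAt
      (fun x : Fin 2 → ℝ => (Qrot (ρ / 2 * Real.log (x 0 ^ 2 + x 1 ^ 2))).mulVec
        ![x 0 * w₀ - x 1 * w₁, x 1 * w₀ + x 0 * w₁])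
      (Matrix.mulVecLin
        (Qrot (ρ * Real.log r) *
          (Qrot ω * !![w₀ - ρ * w₁, -w₁; w₁ + ρ * w₀, w₀] *
            (Qrot ω)ᵀ))).toContinuousLinearMap
      ![r * Real.cos ω, r * Real.sin ω] := by
  set p : Fin 2 → ℝ := ![r * Real.cos ω, r * Real.sin ω] with hp
  have hsq : p 0 ^ 2 + p 1 ^ 2 = r ^ 2 := by
    simp only [hp, Matrix.cons_val_zero, Matrix.cons_val_one]
    linear_combination r ^ 2 * Real.sin_sq_add_cos_sq ω
  have hphase : ρ / 2 * (2 * Real.log r) = ρ * Real.log r := by ring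
  have hp0 : p 0 = r * Real.cos ω := rfl
  have hp1 : p 1 = r * Real.sin ω := rfl
  have h0 : HasFDerivAt (fun x : Fin 2 → ℝ => x 0)
      (ContinuousLinearMap.proj 0 : (Fin 2 → ℝ) →L[ℝ] ℝ) p :=
    hasFDerivAt_apply 0 p
  have h1 : HasFDerivAt (fun x : Fin 2 → ℝ => x 1)
      (ContinuousLinearMap.proj 1 : (Fin 2 → ℝ) →L[ℝ] ℝ) p :=
    hasFDerivAt_apply 1 p
  have hne : p 0 ^ 2 + p 1 ^ 2 ≠ 0 := by rw [hsq]; positivity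
  have hL := (((h0.pow 2).add (h1.pow 2)).log hne).const_mul (ρ / 2)
  have hA := (h0.mul_const w₀).sub (h1.mul_const w₁)
  have hB := (h1.mul_const w₀).add (h0.mul_const w₁)
  have hcs := Real.sin_sq_add_cos_sq ω
  simp only [Qrot_transpose]
  simp only [Qrot, Matrix.mul_fin_two]
  refine hasFDerivAt_pi'.2 fun i => ?_
  fin_cases i
  · have h := (hL.cos.mul hA).sub (hL.sin.mul hB)
    refine (h.congr_fderiv ?_).congr_of_eventuallyEq (.of_forall fun x => ?_)
    · refine ContinuousLinearMap.coe_injective (LinearMap.pi_ext' fun j => LinearMap.ext_ring ?_)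
      fin_cases j <;>
        simp [hsq, hphase, Matrix.mulVec, dotProduct, Fin.sum_univ_two] <;>
        simp only [hp0, hp1] <;>
        field_simp
      · linear_combination -(Real.cos (ρ * Real.log r) * w₀ - Real.sin (ρ * Real.log r) * w₁) * hcs
      · linear_combination -(-(Real.cos (ρ * Real.log r) * w₁) - Real.sin (ρ * Real.log r) * w₀) * hcs
    · simp [Matrix.mulVec, dotProduct, Fin.sum_univ_two]; ring
  · have h := (hL.sin.mul hA).add (hL.cos.mul hB)
    refine (h.congr_fderiv ?_).congr_of_eventuallyEq (.of_forall fun x => ?_)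
    · refine ContinuousLinearMap.coe_injective (LinearMap.pi_ext' fun j => LinearMap.ext_ring ?_)
      fin_cases j <;>
        simp [hsq, hphase, Matrix.mulVec, dotProduct, Fin.sum_univ_two] <;>
        simp only [hp0, hp1] <;>
        field_simp
      · linear_combination -(Real.sin (ρ * Real.log r) * w₀ + Real.cos (ρ * Real.log r) * w₁) * hcs
      · linear_combination -(Real.cos (ρ * Real.log r) * w₀ - Real.sin (ρ * Real.log r) * w₁) * hcs
    · simp [Matrix.mulVec, dotProduct, Fin.sum_univ_two]

/-- Conjugating a matrix by a rotation and rotating the result preserves the determinant. -/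
lemma det_rotation_conj (θ ω : ℝ) (M : Matrix (Fin 2) (Fin 2) ℝ) :
    (Qrot θ * (Qrot ω * M * (Qrot ω)ᵀ)).det = M.det := by
  have h : ∀ t, (Qrot t).det = 1 := fun t => by
    rw [Qrot, Matrix.det_fin_two_of]
    linear_combination Real.sin_sq_add_cos_sq t
  simp [h]

lemma Qrot_transpose_mul_self (θ : ℝ) : (Qrot θ)ᵀ * Qrot θ = 1 := by
  have h := Real.sin_sq_add_cos_sq θ
  ext i j
  fin_cases i <;> fin_cases j <;> simp [Qrot, Matrix.mul_apply] <;> nlinarith [h]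

/-- Conjugating by a rotation and rotating the result preserves the Frobenius norm. -/
lemma trace_gram_rotation_conj (θ ω : ℝ) (M : Matrix (Fin 2) (Fin 2) ℝ) :
    ((Qrot θ * (Qrot ω * M * (Qrot ω)ᵀ))ᵀ * (Qrot θ * (Qrot ω * M * (Qrot ω)ᵀ))).trace =
      (Mᵀ * M).trace := by
  have h : (Qrot θ * (Qrot ω * M * (Qrot ω)ᵀ))ᵀ * (Qrot θ * (Qrot ω * M * (Qrot ω)ᵀ)) =
      Qrot ω * (Mᵀ * M * (Qrot ω)ᵀ) := by
    calc _ = Qrot ω * Mᵀ * (Qrot ω)ᵀ * ((Qrot θ)ᵀ * Qrot θ) * Qrot ω * M * (Qrot ω)ᵀ := by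
          simp only [Matrix.transpose_mul, Matrix.transpose_transpose, Matrix.mul_assoc]
      _ = Qrot ω * Mᵀ * ((Qrot ω)ᵀ * Qrot ω) * M * (Qrot ω)ᵀ := by
          rw [Qrot_transpose_mul_self]; simp only [Matrix.mul_one, Matrix.mul_assoc]
      _ = _ := by
          rw [Qrot_transpose_mul_self]; simp only [Matrix.mul_one, Matrix.mul_assoc]
  rw [h, Matrix.trace_mul_comm, Matrix.mul_assoc, Qrot_transpose_mul_self, Matrix.mul_one]

/-- For `α ∈ (0,1)`, `ρ₀ = (2α−1)/sqrt(α(1−α))`, `a = sqrt((1−α)/α)`,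
`ē = (sqrt(1−α), −sqrt α)` and `ē^⊥` its counterclockwise rotation by `π/2`, the map
`v(r cos ω, r sin ω) = r·Q(ω + ρ₀ log r)·(2 sqrt(α(1−α)), 1−2α)ᵀ` is differentiable on
the annulus `1/2 < r < 1` with total derivative
`∇v = Q(ρ₀ log r)·Q(ω)·(a·ē⊗ē + a⁻¹·ē^⊥⊗ē^⊥)·Q(ω)ᵀ`; in particular `det ∇v = 1` and
the singular values of `∇v` are `a` and `a⁻¹` at every point of the annulus. -/
theorem limit_deformation_gradient (α : ℝ) (hα : α ∈ Set.Ioo (0 : ℝ) 1)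
    (ρ₀ a : ℝ) (hρ₀ : ρ₀ = (2 * α - 1) / Real.sqrt (α * (1 - α)))
    (ha : a = Real.sqrt ((1 - α) / α))
    (e e' : Fin 2 → ℝ) (he : e = ![Real.sqrt (1 - α), -Real.sqrt α])
    (he' : e' = ![Real.sqrt α, Real.sqrt (1 - α)])
    (v : (Fin 2 → ℝ) → (Fin 2 → ℝ))
    (hv : ∀ r ω : ℝ, 0 < r →
      v ![r * Real.cos ω, r * Real.sin ω] =
        r • (Qrot (ω + ρ₀ * Real.log r)).mulVec
          ![2 * Real.sqrt (α * (1 - α)), 1 - 2 * α]) :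
    ∀ r ω : ℝ, 1 / 2 < r → r < 1 →
      HasFDerivAt v
        (Matrix.mulVecLin
          (Qrot (ρ₀ * Real.log r) *
            (Qrot ω * (a • vecMulVec e e + a⁻¹ • vecMulVec e' e') * (Qrot ω)ᵀ))).toContinuousLinearMap
        ![r * Real.cos ω, r * Real.sin ω] ∧
      (Qrot (ρ₀ * Real.log r) *
          (Qrot ω * (a • vecMulVec e e + a⁻¹ • vecMulVec e' e') * (Qrot ω)ᵀ)).det = 1 ∧
      (∀ G : Matrix (Fin 2) (Fin 2) ℝ,
        G = Qrot (ρ₀ * Real.log r) *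
              (Qrot ω * (a • vecMulVec e e + a⁻¹ • vecMulVec e' e') * (Qrot ω)ᵀ) →
        (Gᵀ * G).trace = a ^ 2 + (a⁻¹) ^ 2 ∧ (Gᵀ * G).det = (a * a⁻¹) ^ 2) := by
  obtain ⟨hα0, hα1⟩ := hα
  have h1α : 0 < 1 - α := sub_pos.2 hα1
  obtain ⟨s, hs⟩ : ∃ s, s = Real.sqrt α := ⟨_, rfl⟩
  obtain ⟨c, hc⟩ : ∃ c, c = Real.sqrt (1 - α) := ⟨_, rfl⟩
  have hs0 : 0 < s := hs ▸ Real.sqrt_pos.2 hα0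
  have hc0 : 0 < c := hc ▸ Real.sqrt_pos.2 h1α
  have hs2 : s ^ 2 = α := by rw [hs, Real.sq_sqrt hα0.le]
  have hc2 : c ^ 2 = 1 - s ^ 2 := by rw [hc, Real.sq_sqrt h1α.le, hs2]
  rw [Real.sqrt_div h1α.le, ← hs, ← hc] at ha
  rw [Real.sqrt_mul hα0.le, ← hs, ← hc, ← hs2] at hρ₀
  rw [← hs, ← hc] at he he'
  rw [Real.sqrt_mul hα0.le, ← hs, ← hc, ← hs2] at hv
  set M := a • vecMulVec e e + a⁻¹ • vecMulVec e' e' with hM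
  have hMw : M = !![2 * (s * c) - ρ₀ * (1 - 2 * s ^ 2), -(1 - 2 * s ^ 2);
      (1 - 2 * s ^ 2) + ρ₀ * (2 * (s * c)), 2 * (s * c)] := by
    ext i j
    fin_cases i <;> fin_cases j <;>
      simp [hM, he, he', ha, hρ₀] <;> field_simp
    · linear_combination (c ^ 2 + 1 - 3 * s ^ 2) * hc2
    · linear_combination -hc2
    · linear_combination -hc2
    · ring
  have hdet : M.det = 1 := by
    rw [hMw, Matrix.det_fin_two_of, hρ₀]
    field_simp
    linear_combination 4 * s ^ 2 * hc2
  have htr : (Mᵀ * M).trace = a ^ 2 + a⁻¹ ^ 2 := by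
    rw [hMw, ha, hρ₀]
    simp [Matrix.trace_fin_two, Matrix.mul_apply]
    field_simp
    linear_combination
      ((8 * s ^ 4 - 1) * (c ^ 2 + 1 - s ^ 2) + 6 * s ^ 2 * (2 * s ^ 2 - 1) ^ 2) * hc2
  have ha0 : a ≠ 0 := by rw [ha]; positivity
  intro r ω hr _
  have hr0 : 0 < r := by linarith
  refine ⟨?_, by rw [det_rotation_conj, hdet], ?_⟩
  · rw [hMw]
    refine (hasFDerivAt_spiral ρ₀ (2 * (s * c)) (1 - 2 * s ^ 2) r ω hr0).congr_of_eventuallyEq ?_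
    have hp : (![r * Real.cos ω, r * Real.sin ω] : Fin 2 → ℝ) ≠ 0 := fun h => by
      have h0 : r * Real.cos ω = 0 := congrFun h 0
      have h1 : r * Real.sin ω = 0 := congrFun h 1
      have : r ^ 2 = 0 := by
        linear_combination (-r ^ 2) * Real.sin_sq_add_cos_sq ω + r * Real.cos ω * h0 +
          r * Real.sin ω * h1
      exact pow_ne_zero 2 hr0.ne' this
    filter_upwards [isOpen_ne.mem_nhds hp] with x hx
    obtain ⟨t, θ, ht, rfl⟩ := exists_polar_coordinates x hx
    have hsq : (t * Real.cos θ) ^ 2 + (t * Real.sin θ) ^ 2 = t ^ 2 := by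
      linear_combination t ^ 2 * Real.sin_sq_add_cos_sq θ
    have hlog : ρ₀ / 2 * Real.log (t ^ 2) = ρ₀ * Real.log t := by
      rw [Real.log_pow]; push_cast; ring
    rw [hv t θ ht]
    simp only [Matrix.cons_val_zero, Matrix.cons_val_one, hsq, hlog]
    ext i
    fin_cases i <;>
      simp [Qrot, Matrix.mulVec, dotProduct, Fin.sum_univ_two, Real.cos_add, Real.sin_add] <;> ring
  · rintro G rfl
    refine ⟨by rw [trace_gram_rotation_conj, htr], ?_⟩
    rw [Matrix.det_mul, Matrix.det_transpose, det_rotation_conj, hdet, mul_inv_cancel₀ ha0]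
    norm_num
end
end

section
/- Let n ≥ 3 be an odd integer, let E₁ be the 2×2 matrix with rows (1, −tan(π/n)) and (−tan(π/n), −1), and let 𝒫̂_n = {Q(2πj/n) : 0 ≤ j ≤ n−1} ∪ {diag(1,−1)·Q(2πj/n) : 0 ≤ j ≤ n−1} be the dihedral group of order 2n, where Q(θ) = ((cos θ, −sin θ),(sin θ, cos θ)). Then the set K = { R·E₁·Rᵀ : R ∈ 𝒫̂_n } has exactly n elements. -/
open Real Matrix

noncomputable section

/-- The trace-free symmetric matrix with first row `c • (cos t, sin t)`. -/
def traceFreeSymm (c t : ℝ) : Matrix (Fin 2) (Fin 2) ℝ :=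
  !![c * Real.cos t, c * Real.sin t; c * Real.sin t, -(c * Real.cos t)]

theorem Qrot_conj_traceFreeSymm (c θ t : ℝ) :
    Qrot θ * traceFreeSymm c t * (Qrot θ)ᵀ = traceFreeSymm c (t + 2 * θ) := by
  have h := Real.sin_sq_add_cos_sq θ
  ext i j
  fin_cases i <;> fin_cases j <;>
    simp [Qrot, traceFreeSymm, Matrix.mul_apply, Fin.sum_univ_two, Real.cos_add, Real.sin_add,
      Real.cos_two_mul', Real.sin_two_mul] <;> ring

theorem reflection_conj_traceFreeSymm (c t : ℝ) :
    !![(1 : ℝ), 0; 0, -1] * traceFreeSymm c t * (!![(1 : ℝ), 0; 0, -1])ᵀ =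
      traceFreeSymm c (-t) := by
  ext i j
  fin_cases i <;> fin_cases j <;>
    simp [traceFreeSymm, Matrix.mul_apply, Fin.sum_univ_two]

theorem traceFreeSymm_eq_iff {c : ℝ} (hc : c ≠ 0) (s t : ℝ) :
    traceFreeSymm c s = traceFreeSymm c t ↔ ∃ k : ℤ, s - t = 2 * π * k := by
  rw [← Real.Angle.angle_eq_iff_two_pi_dvd_sub]
  refine ⟨fun h => ?_, fun h => ?_⟩
  · have h0 := congrFun (congrFun h 0) 0
    have h1 := congrFun (congrFun h 0) 1
    simp only [traceFreeSymm, Matrix.of_apply, Matrix.cons_val_zero, Matrix.cons_val_one,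
      Matrix.cons_val', Matrix.cons_val_fin_one] at h0 h1
    exact Real.Angle.cos_sin_inj (mul_left_cancel₀ hc h0) (mul_left_cancel₀ hc h1)
  · simp only [traceFreeSymm, ← Real.Angle.cos_coe, ← Real.Angle.sin_coe, h]

/-- For odd `n ≥ 3` and `E₁ = ((1, −tan(π/n)), (−tan(π/n), −1))`,
the conjugation orbit `K = {R·E₁·Rᵀ : R ∈ 𝒫̂_n}` of `E₁` under the dihedral group of
order `2n` has exactly `n` elements. -/
theorem number_of_linearised_wells (n : ℕ) (hn : 3 ≤ n) (hodd : Odd n)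
    (E₁ : Matrix (Fin 2) (Fin 2) ℝ)
    (hE₁ : E₁ = !![(1 : ℝ), -Real.tan (π / n); -Real.tan (π / n), -1]) :
    Set.ncard {M : Matrix (Fin 2) (Fin 2) ℝ | ∃ R ∈ dihedral n, M = R * E₁ * Rᵀ} = n := by
  have hn0 : (n : ℝ) ≠ 0 := by positivity
  have hπ := Real.pi_ne_zero
  have hcos : Real.cos (π / n) ≠ 0 := by
    have h3 : (3 : ℝ) ≤ n := by exact_mod_cast hn
    have hlt : π / n < π / 2 := by gcongr; linarith
    have hpos : 0 < π / n := by positivity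
    exact (Real.cos_pos_of_mem_Ioo ⟨by linarith, hlt⟩).ne'
  set c := (Real.cos (π / n))⁻¹ with hc_def
  have hc : c ≠ 0 := inv_ne_zero hcos
  have hE : E₁ = traceFreeSymm c (-(π / n)) := by
    rw [hE₁, traceFreeSymm, Real.tan_eq_sin_div_cos, Real.cos_neg, Real.sin_neg, hc_def,
      inv_mul_cancel₀ hcos, div_eq_inv_mul, mul_neg]
  set f : ℕ → Matrix (Fin 2) (Fin 2) ℝ :=
    fun j => traceFreeSymm c (-(π / n) + 2 * (2 * π * j / n)) with hf
  have hrot (j : ℕ) : Qrot (2 * π * j / n) * E₁ * (Qrot (2 * π * j / n))ᵀ = f j := by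
    rw [hE, Qrot_conj_traceFreeSymm]
  have hrefl (j : ℕ) : !![(1 : ℝ), 0; 0, -1] * Qrot (2 * π * j / n) * E₁ *
      (!![(1 : ℝ), 0; 0, -1] * Qrot (2 * π * j / n))ᵀ =
        traceFreeSymm c (-(-(π / n) + 2 * (2 * π * j / n))) := by
    rw [← reflection_conj_traceFreeSymm, ← Qrot_conj_traceFreeSymm, ← hE, Matrix.transpose_mul]
    simp only [Matrix.mul_assoc]
  have hset : {M : Matrix (Fin 2) (Fin 2) ℝ | ∃ R ∈ dihedral n, M = R * E₁ * Rᵀ} =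
      f '' (Finset.range n : Set ℕ) := by
    ext M
    simp only [Set.mem_ofPred_eq, Set.mem_image, Finset.coe_range, Set.mem_Iio]
    constructor
    · rintro ⟨R, ⟨j, hj, rfl⟩ | ⟨j, hj, rfl⟩, rfl⟩
      · exact ⟨j, hj, (hrot j).symm⟩
      · -- `i ≡ (n + 1) / 2 - j` modulo `n`, so that `2 * (i + j) ≡ 1`
        obtain ⟨m, hm⟩ := hodd
        obtain ⟨k, hk⟩ : ∃ k : ℕ, m + 1 + (n - j) = (m + 1 + (n - j)) % n + n * k :=
          ⟨_, (Nat.mod_add_div _ _).symm⟩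
        refine ⟨(m + 1 + (n - j)) % n, Nat.mod_lt _ (by lia), ?_⟩
        generalize (m + 1 + (n - j)) % n = i at hk
        rw [hrefl, hf, traceFreeSymm_eq_iff hc]
        refine ⟨3 - 2 * k, ?_⟩
        have hm' : (n : ℝ) = 2 * m + 1 := by exact_mod_cast hm
        have hk' : (m : ℝ) + 1 + (n - j) = i + n * k := by
          rw [← Nat.cast_sub hj.le]; exact_mod_cast hk
        push_cast
        field_simp
        linear_combination (-4) * hk' - 2 * hm'
    · rintro ⟨j, hj, rfl⟩
      exact ⟨_, Or.inl ⟨j, hj, rfl⟩, (hrot j).symm⟩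
  have hinj : Set.InjOn f (Finset.range n : Set ℕ) := by
    intro i hi j hj hij
    simp only [Finset.coe_range, Set.mem_Iio] at hi hj
    obtain ⟨k, hk⟩ := (traceFreeSymm_eq_iff hc _ _).1 hij
    have hk' : 2 * ((i : ℝ) - j) = n * k := by
      field_simp at hk
      linear_combination hk / 2
    have hdvd : (n : ℤ) ∣ 2 * ((i : ℤ) - j) := ⟨k, by exact_mod_cast hk'⟩
    have hcop : IsCoprime (n : ℤ) 2 := by
      exact_mod_cast Nat.isCoprime_iff_coprime.2 hodd.coprime_two_right
    have hmod : j ≡ i [MOD n] := (Nat.modEq_iff_dvd).2 (hcop.dvd_of_dvd_mul_left hdvd)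
    exact (hmod.eq_of_lt_of_lt hj hi).symm
  rw [hset, hinj.ncard_image, Set.ncard_coe_finset, Finset.card_range]
end
end

section
/- Let n ≥ 3 be an odd integer, let E₁ be the 2×2 matrix with rows (1, −tan(π/n)) and (−tan(π/n), −1), P₀ = diag(1,−1), and Q(θ) = ((cos θ, −sin θ),(sin θ, cos θ)). Then: (i) Q(π(n−1)/n)·P₀·E₁·P₀·Q(π(n−1)/n)ᵀ = E₁, and (ii) Q(π/n)·E₁·Q(π/n)ᵀ = Q(2π/n)·E₁ = P₀·E₁·P₀. -/
open Real Matrix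

noncomputable section

/-- For odd `n ≥ 3`, `E₁ = ((1, −tan(π/n)), (−tan(π/n), −1))` and
`P₀ = diag(1,−1)`:
(i) `Q(π(n−1)/n)·P₀·E₁·P₀·Q(π(n−1)/n)ᵀ = E₁`, and
(ii) `Q(π/n)·E₁·Q(π/n)ᵀ = Q(2π/n)·E₁ = P₀·E₁·P₀`. -/
theorem linearised_symmetries (n : ℕ) (hn : 3 ≤ n) (hodd : Odd n)
    (E₁ P₀ : Matrix (Fin 2) (Fin 2) ℝ)
    (hE₁ : E₁ = !![(1 : ℝ), -Real.tan (π / n); -Real.tan (π / n), -1])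
    (hP₀ : P₀ = !![(1 : ℝ), 0; 0, -1]) :
    (Qrot (π * ((n : ℝ) - 1) / n) * P₀ * E₁ * P₀ * (Qrot (π * ((n : ℝ) - 1) / n))ᵀ = E₁) ∧
      Qrot (π / n) * E₁ * (Qrot (π / n))ᵀ = Qrot (2 * π / n) * E₁ ∧
      Qrot (2 * π / n) * E₁ = P₀ * E₁ * P₀ := by
  have hn' : (3 : ℝ) ≤ n := by exact_mod_cast hn
  have hangle : π * ((n : ℝ) - 1) / n = π - π / n := by field_simp
  have hdouble : 2 * π / n = 2 * (π / n) := by ring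
  have hcos : Real.cos (π / n) ≠ 0 := by
    refine (Real.cos_pos_of_mem_Ioo ⟨?_, ?_⟩).ne'
    · have : 0 < π / n := by positivity
      linarith [Real.pi_pos]
    · exact div_lt_div_of_pos_left Real.pi_pos two_pos (by linarith)
  rw [hangle, hdouble, hE₁, hP₀]
  have htan := Real.tan_mul_cos hcos
  have hsq := Real.sin_sq_add_cos_sq (π / n)
  generalize Real.tan (π / n) = t at *
  simp only [Qrot, Real.cos_pi_sub, Real.sin_pi_sub, Real.cos_two_mul, Real.sin_two_mul]
  generalize Real.sin (π / n) = s at *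
  generalize Real.cos (π / n) = c at *
  refine ⟨?_, ?_, ?_⟩ <;> ext i j <;> fin_cases i <;> fin_cases j <;>
    simp [Matrix.mul_apply, Fin.sum_univ_two] <;> grind
end
end

section
/- Define w : ℝ² ∖ {0} → ℝ² by w(x₁,x₂) = 2·(1 − log(x₁² + x₂²))·(x₂, −x₁). Then w is differentiable at every x ≠ 0 and the symmetrised gradient e(∇w)(x) = (1/2)(∇w(x) + ∇w(x)ᵀ) equals (2/(x₁²+x₂²))·((−2x₁x₂, x₁²−x₂²),(x₁²−x₂², 2x₁x₂)); in particular, at every x ≠ 0 the matrix e(∇w)(x) is symmetric and trace-free and can be written as c·((a,b),(b,−a)) with a² + b² = 1 and c = 2, i.e. it is of the form c·R·diag(1,−1)·Rᵀ for some R ∈ O(2). -/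
open Real Matrix

noncomputable section

/-- Let `w(x₁,x₂) = 2(1 − log(x₁²+x₂²))·(x₂,−x₁)`. Then `w` is
differentiable at every `x ≠ 0`, its symmetrised gradient
`e(∇w) = (1/2)(∇w + ∇wᵀ)` equals
`(2/(x₁²+x₂²))·((−2x₁x₂, x₁²−x₂²),(x₁²−x₂², 2x₁x₂))`; in particular `e(∇w)(x)` is
symmetric and trace-free, and is of the form `2·((a,b),(b,−a))` with `a²+b²=1`, i.e.
`2·R·diag(1,−1)·Rᵀ` for some `R ∈ O(2)`. -/
theorem linearised_limit_solution (w : (Fin 2 → ℝ) → (Fin 2 → ℝ))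
    (hw : ∀ x : Fin 2 → ℝ,
      w x = (2 * (1 - Real.log ((x 0) ^ 2 + (x 1) ^ 2))) • ![x 1, -(x 0)]) :
    ∀ x : Fin 2 → ℝ, x ≠ 0 →
      ∃ G : Matrix (Fin 2) (Fin 2) ℝ,
        HasFDerivAt w (Matrix.mulVecLin G).toContinuousLinearMap x ∧
        (2⁻¹ : ℝ) • (G + Gᵀ) =
          (2 / ((x 0) ^ 2 + (x 1) ^ 2)) •
            !![-(2 * x 0 * x 1), (x 0) ^ 2 - (x 1) ^ 2;
               (x 0) ^ 2 - (x 1) ^ 2, 2 * x 0 * x 1] ∧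
        ((2⁻¹ : ℝ) • (G + Gᵀ))ᵀ = (2⁻¹ : ℝ) • (G + Gᵀ) ∧
        ((2⁻¹ : ℝ) • (G + Gᵀ)).trace = 0 ∧
        (∃ a b : ℝ, a ^ 2 + b ^ 2 = 1 ∧
          (2⁻¹ : ℝ) • (G + Gᵀ) = (2 : ℝ) • !![a, b; b, -a]) ∧
        (∃ R : Matrix (Fin 2) (Fin 2) ℝ, R * Rᵀ = 1 ∧
          (2⁻¹ : ℝ) • (G + Gᵀ) = (2 : ℝ) • (R * !![(1 : ℝ), 0; 0, -1] * Rᵀ)) := by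
  intro x hx
  have hr : 0 < x 0 ^ 2 + x 1 ^ 2 := by
    by_contra h
    refine hx (funext fun i => ?_)
    fin_cases i
    · simp only [Fin.zero_eta, Pi.zero_apply]
      nlinarith [sq_nonneg (x 0), sq_nonneg (x 1)]
    · simp only [Fin.mk_one, Pi.zero_apply]
      nlinarith [sq_nonneg (x 0), sq_nonneg (x 1)]
  have hr' := hr.ne'
  set r := x 0 ^ 2 + x 1 ^ 2 with hrdef
  set l := 2 * (1 - Real.log r) with hl
  set G : Matrix (Fin 2) (Fin 2) ℝ :=
    !![-(4 * x 0 * x 1) / r, l - 4 * x 1 ^ 2 / r;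
       -l + 4 * x 0 ^ 2 / r, 4 * x 0 * x 1 / r] with hG
  have hsym : (2⁻¹ : ℝ) • (G + Gᵀ) =
      (2 / r) • !![-(2 * x 0 * x 1), x 0 ^ 2 - x 1 ^ 2; x 0 ^ 2 - x 1 ^ 2, 2 * x 0 * x 1] := by
    ext i j
    fin_cases i <;> fin_cases j <;> simp [hG] <;> ring
  refine ⟨G, ?_, hsym, ?_, ?_, ?_, ?_⟩
  · have h0 : HasFDerivAt (fun y : Fin 2 → ℝ => y 0) _ x := hasFDerivAt_apply (𝕜 := ℝ) 0 x
    have h1 : HasFDerivAt (fun y : Fin 2 → ℝ => y 1) _ x := hasFDerivAt_apply (𝕜 := ℝ) 1 x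
    have hlog := ((((h0.pow 2).add (h1.pow 2)).log hr').const_sub 1).const_mul 2
    rw [hasFDerivAt_pi']
    intro i
    fin_cases i
    · refine ((hlog.mul h1).congr_of_eventuallyEq (.of_forall fun y => ?_)).congr_fderiv ?_
      · simp [hw]
      · ext v
        simp [hG, dotProduct, Fin.sum_univ_two, ← hrdef, ← hl]
        ring
    · refine ((hlog.mul h0.neg).congr_of_eventuallyEq (.of_forall fun y => ?_)).congr_fderiv ?_
      · simp [hw]
      · ext v
        simp [hG, dotProduct, Fin.sum_univ_two, ← hrdef, ← hl]
        ring
  · rw [hsym]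
    ext i j
    fin_cases i <;> fin_cases j <;> simp
  · rw [hsym]
    simp [Matrix.trace_fin_two]
  · refine ⟨-(2 * x 0 * x 1) / r, (x 0 ^ 2 - x 1 ^ 2) / r, ?_, ?_⟩
    · field_simp
      rw [hrdef]
      ring
    · rw [hsym]
      ext i j
      fin_cases i <;> fin_cases j <;> simp <;> ring
  · obtain ⟨k, hk⟩ : ∃ k : ℝ, k ^ 2 = 1 / (2 * r) :=
      ⟨√(1 / (2 * r)), Real.sq_sqrt (by positivity)⟩
    have hk' : k ^ 2 * (2 * r) = 1 := by rw [hk]; field_simp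
    have hkr : 2 / r = 4 * k ^ 2 := by rw [hk]; field_simp; norm_num
    rw [hrdef] at hk'
    refine ⟨!![k * (x 0 - x 1), -(k * (x 0 + x 1)); k * (x 0 + x 1), k * (x 0 - x 1)], ?_, ?_⟩
    · ext i j
      fin_cases i <;> fin_cases j <;> simp [Matrix.mul_apply, Fin.sum_univ_two] <;>
        first | ring1 | linear_combination hk'
    · rw [hsym, hkr]
      ext i j
      fin_cases i <;> fin_cases j <;> simp [Matrix.vecMul, dotProduct] <;> ring
end
end

section
/- Define w : ℝ² ∖ {0} → ℝ² by w(x₁,x₂) = 2·(1 − log(x₁² + x₂²))·(x₂, −x₁). Then there exists a constant c > 0 (namely c = 3/8) such that for every x with 1/2 < |x| < 1 the matrix E(x) = e(∇(c·w))(x) + diag(1/4, 1/4) is symmetric with trace(E(x)) = 1/2 and has eigenvalues −1/2 and 1, i.e. (E₁₁(x) − 1/4)² + (E₁₂(x))² = 9/16. -/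
open Real Matrix Polynomial

noncomputable section

/-- A symmetric `2 × 2` matrix of trace `1 / 2` whose traceless part has entries `a`, `b` with
`a ^ 2 + b ^ 2 = 9 / 16` has eigenvalues `-1 / 2` and `1`. -/
theorem symm_trace_charpoly_of_entries {E : Matrix (Fin 2) (Fin 2) ℝ} {a b : ℝ}
    (hE : E = !![1 / 4 + a, b; b, 1 / 4 - a]) (hab : a ^ 2 + b ^ 2 = 9 / 16) :
    Eᵀ = E ∧ E.trace = 1 / 2 ∧ E.charpoly = (X + C (1 / 2)) * (X - C 1) ∧
      (E 0 0 - 1 / 4) ^ 2 + (E 0 1) ^ 2 = 9 / 16 := by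
  subst hE
  have htr : (!![1 / 4 + a, b; b, 1 / 4 - a]).trace = 1 / 2 := by
    simp [Matrix.trace_fin_two]
    ring
  have hdet : (!![1 / 4 + a, b; b, 1 / 4 - a]).det = -(1 / 2) := by
    rw [Matrix.det_fin_two_of]
    linear_combination -hab
  refine ⟨?_, htr, ?_, by simpa using hab⟩
  · ext i j
    fin_cases i <;> fin_cases j <;> simp
  · have hC : C (1 / 2 : ℝ) + C (1 / 2) = C 1 := by
      rw [← C_add]
      norm_num
    rw [Matrix.charpoly_fin_two, htr, hdet, C_neg]
    simp only [C_1] at hC ⊢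
    linear_combination (-X) * hC

/-- Let `w(x₁,x₂) = 2(1 − log(x₁²+x₂²))·(x₂,−x₁)`. Then there exists
`c > 0` (namely `c = 3/8`) such that for every `x` with `1/2 < |x| < 1`, the matrix
`E(x) = e(∇(c·w))(x) + diag(1/4,1/4)` is symmetric with `trace E(x) = 1/2` and has
eigenvalues `−1/2` and `1`, i.e. `(E₁₁(x) − 1/4)² + (E₁₂(x))² = 9/16`. -/
theorem linearised_nematic_solution (w : (Fin 2 → ℝ) → (Fin 2 → ℝ))
    (hw : ∀ x : Fin 2 → ℝ,
      w x = (2 * (1 - Real.log ((x 0) ^ 2 + (x 1) ^ 2))) • ![x 1, -(x 0)]) :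
    ∃ c : ℝ, 0 < c ∧ c = 3 / 8 ∧
      ∀ x : Fin 2 → ℝ,
        1 / 2 < Real.sqrt ((x 0) ^ 2 + (x 1) ^ 2) →
        Real.sqrt ((x 0) ^ 2 + (x 1) ^ 2) < 1 →
        ∃ G : Matrix (Fin 2) (Fin 2) ℝ,
          HasFDerivAt (fun y => c • w y) (Matrix.mulVecLin G).toContinuousLinearMap x ∧
          ∀ E : Matrix (Fin 2) (Fin 2) ℝ,
            E = (2⁻¹ : ℝ) • (G + Gᵀ) + !![(1 : ℝ) / 4, 0; 0, 1 / 4] →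
            Eᵀ = E ∧ E.trace = 1 / 2 ∧
              E.charpoly = (X + C (1 / 2)) * (X - C 1) ∧
              (E 0 0 - 1 / 4) ^ 2 + (E 0 1) ^ 2 = 9 / 16 := by
  refine ⟨3 / 8, by norm_num, rfl, fun x hx _ => ?_⟩
  have hr : (x 0) ^ 2 + (x 1) ^ 2 ≠ 0 := by
    intro h
    rw [h, Real.sqrt_zero] at hx
    norm_num at hx
  have h0 : HasFDerivAt (fun y : Fin 2 → ℝ => y 0)
      (ContinuousLinearMap.proj (R := ℝ) (φ := fun _ : Fin 2 => ℝ) 0) x := hasFDerivAt_apply 0 x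
  have h1 : HasFDerivAt (fun y : Fin 2 → ℝ => y 1)
      (ContinuousLinearMap.proj (R := ℝ) (φ := fun _ : Fin 2 => ℝ) 1) x := hasFDerivAt_apply 1 x
  have hL := (((h0.pow 2).add (h1.pow 2)).log hr).const_sub 1 |>.const_mul 2
  set r := (x 0) ^ 2 + (x 1) ^ 2 with hrdef
  set L := 2 * (1 - Real.log r)
  refine ⟨(3 / 8 : ℝ) • !![-4 * x 0 * x 1 / r, L - 4 * (x 1) ^ 2 / r;
      -L + 4 * (x 0) ^ 2 / r, 4 * x 0 * x 1 / r], ?_, ?_⟩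
  · rw [hasFDerivAt_pi']
    intro i
    fin_cases i
    · refine HasFDerivAt.congr_fderiv (((hL.mul h1).const_mul
        (3 / 8)).congr_of_eventuallyEq (Filter.Eventually.of_forall fun y => by simp [hw])) ?_
      ext v
      simp [dotProduct, Fin.sum_univ_two, ← hrdef]
      field_simp
      ring
    · refine HasFDerivAt.congr_fderiv (((hL.mul h0.neg).const_mul
        (3 / 8)).congr_of_eventuallyEq (Filter.Eventually.of_forall fun y => by simp [hw])) ?_
      ext v
      simp [dotProduct, Fin.sum_univ_two, ← hrdef]
      field_simp
      ring
  · rintro E rfl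
    have key : ((3 : ℝ) / 8 * (-4 * x 0 * x 1 / r)) ^ 2
        + ((3 : ℝ) / 16 * (4 * (x 0) ^ 2 / r - 4 * (x 1) ^ 2 / r)) ^ 2 = 9 / 16 := by
      field_simp
      rw [hrdef]
      ring
    refine symm_trace_charpoly_of_entries ?_ key
    ext i j
    fin_cases i <;> fin_cases j <;> simp <;> ring
end
end

section
/- Let 𝒫 be a set of orthogonal real 2×2 matrices (𝒫 ⊆ O(2)), and let M, U ∈ ℝ^{2×2} with det(M) = det(U) > 0. Then M ∈ ⋃_{P ∈ 𝒫} SO(2)·Pᵀ·U·P if and only if MᵀM ∈ ⋃_{P ∈ 𝒫} Pᵀ·Uᵀ·U·P. -/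
open Matrix

/-- The set of orthogonal matrices `O(2)`, realised as `2×2` real matrices. -/
def O2 : Set (Matrix (Fin 2) (Fin 2) ℝ) := {P | P * Pᵀ = 1}

/-- Two matrices with the same nonzero determinant differ by a rotation on the left if and only if
their Gram matrices agree. -/
theorem exists_mem_SO2_eq_mul_iff {M N : Matrix (Fin 2) (Fin 2) ℝ} (hdet : M.det = N.det)
    (hN : N.det ≠ 0) : (∃ R ∈ SO2, M = R * N) ↔ Mᵀ * M = Nᵀ * N := by
  constructor
  · rintro ⟨R, ⟨hR, -⟩, rfl⟩
    rw [transpose_mul, Matrix.mul_assoc, ← Matrix.mul_assoc Rᵀ, mul_eq_one_comm.mp hR,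
      Matrix.one_mul]
  · intro h
    have hu : IsUnit N.det := hN.isUnit
    refine ⟨M * N⁻¹, ⟨mul_eq_one_comm.mp ?_, ?_⟩, (nonsing_inv_mul_cancel_right N M hu).symm⟩
    · calc (M * N⁻¹)ᵀ * (M * N⁻¹) = (N⁻¹)ᵀ * (Mᵀ * M) * N⁻¹ := by
            simp only [transpose_mul, Matrix.mul_assoc]
        _ = (N * N⁻¹)ᵀ * (N * N⁻¹) := by
            rw [h]; simp only [transpose_mul, Matrix.mul_assoc]
        _ = 1 := by rw [mul_nonsing_inv N hu, transpose_one, Matrix.one_mul]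
    · rw [det_mul, hdet, ← det_mul, mul_nonsing_inv N hu, det_one]

/-- Let `Psym ⊆ O(2)` and `M, U ∈ ℝ^{2×2}` with `det M = det U > 0`.
Then `M ∈ ⋃_{P ∈ Psym} SO(2)·Pᵀ·U·P` if and only if
`MᵀM ∈ ⋃_{P ∈ Psym} Pᵀ·Uᵀ·U·P`. -/
theorem reduction_to_cauchy_green (Psym : Set (Matrix (Fin 2) (Fin 2) ℝ)) (hPsym : Psym ⊆ O2)
    (M U : Matrix (Fin 2) (Fin 2) ℝ) (hdet : M.det = U.det) (hpos : 0 < M.det) :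
    (∃ P ∈ Psym, ∃ R ∈ SO2, M = R * (Pᵀ * U * P)) ↔
      ∃ P ∈ Psym, Mᵀ * M = Pᵀ * (Uᵀ * U) * P := by
  refine exists_congr fun P => and_congr_right fun hP => ?_
  have hPP : P * Pᵀ = 1 := hPsym hP
  have hconj : (Pᵀ * U * P).det = U.det := by
    rw [det_mul_right_comm, det_mul, mul_eq_one_comm.mp hPP, det_one, one_mul]
  have hgram : (Pᵀ * U * P)ᵀ * (Pᵀ * U * P) = Pᵀ * (Uᵀ * U) * P := by
    calc (Pᵀ * U * P)ᵀ * (Pᵀ * U * P) = Pᵀ * (Uᵀ * ((P * Pᵀ) * U)) * P := by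
          simp only [transpose_mul, transpose_transpose, Matrix.mul_assoc]
      _ = Pᵀ * (Uᵀ * U) * P := by rw [hPP, Matrix.one_mul]
  rw [exists_mem_SO2_eq_mul_iff (hdet.trans hconj.symm) (by rw [hconj, ← hdet]; exact hpos.ne'),
    hgram]
end
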